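/- Fix β > 0, λ ≥ 0, η, b ∈ (0,1), and a closed set U ⊆ [η,1] × ℝ³; let V_n = [−1 + e^{−n^b}, 1 − e^{−n^b}] and C₀ > 0 a constant. Then limsup_{n→∞} (1/n) log T(U, V_n) ≤ sup_{ρ ∈ P : (Q(ρ), M(ρ), A(ρ), E(ρ)) ∈ U} sup_{y ∈ ℝ} { J(ρ, y) − H(ρ | π₀) − y²/(2β²) + log 2 }, where π₀ is the uniform distribution on (−1,1) and H(· | ·) is relative entropy. -/

import Mathlib

open MeasureTheory ProbabilityTheory Real Filter
open scoped ENNReal NNReal Classical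

noncomputable section

/-- The open interval `(−1,1)` as a type. -/
abbrev Int11 : Type := ↥(Set.Ioo (-1 : ℝ) 1)

/-- Inverse hyperbolic tangent. -/
def atanh (x : ℝ) : ℝ := Real.log ((1 + x) / (1 - x)) / 2

/-- Binary entropy function. -/
def ent (m : ℝ) : ℝ :=
  -((1 + m) / 2) * Real.log ((1 + m) / 2) - ((1 - m) / 2) * Real.log ((1 - m) / 2)

/-- `Q(ρ) = ∫ x² ρ(dx)`. -/
def Qm (ρ : ProbabilityMeasure Int11) : ℝ := ∫ x, (x : ℝ) ^ 2 ∂(ρ : Measure Int11)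

/-- `M(ρ) = ∫ x ρ(dx)`. -/
def Mm (ρ : ProbabilityMeasure Int11) : ℝ := ∫ x, (x : ℝ) ∂(ρ : Measure Int11)

/-- `A(ρ) = ∫ x arctanh(x) ρ(dx)`. -/
def Am (ρ : ProbabilityMeasure Int11) : ℝ :=
  ∫ x, (x : ℝ) * atanh (x : ℝ) ∂(ρ : Measure Int11)

/-- `E(ρ) = −∫ [h(x) + (1/2)x arctanh(x)] ρ(dx) − (β²/4)(1 − Q(ρ)²)`. -/
def Em (β : ℝ) (ρ : ProbabilityMeasure Int11) : ℝ :=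
  -∫ x, (ent (x : ℝ) + (x : ℝ) * atanh (x : ℝ) / 2) ∂(ρ : Measure Int11)
    - β ^ 2 / 4 * (1 - (Qm ρ) ^ 2)

/-- `g(x; φ, q, y)`. -/
def gdens (β lam x φ q y : ℝ) : ℝ :=
  (1 - x ^ 2)⁻¹ *
    Real.exp (-(atanh x - β * lam * φ + β ^ 2 * (1 - q) * x - y * x) ^ 2 / (2 * β ^ 2 * q))

/-- The extended-real functional `J(ρ,y)`. -/
def JE (β lam : ℝ) (ρ : ProbabilityMeasure Int11) (y : ℝ) : EReal :=
  ((β ^ 2 * (1 - Qm ρ) ^ 2 / 2 - Real.log (2 * π * β ^ 2 * Qm ρ) / 2 : ℝ) : EReal)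
  + ((∫⁻ x, ENNReal.ofReal (Real.log (gdens β lam x (Mm ρ) (Qm ρ) y))
        ∂(ρ : Measure Int11) : ℝ≥0∞) : EReal)
  - ((∫⁻ x, ENNReal.ofReal (-Real.log (gdens β lam x (Mm ρ) (Qm ρ) y))
        ∂(ρ : Measure Int11) : ℝ≥0∞) : EReal)

/-- Relative entropy `H(μ|π)`, as an extended real number (`+∞` if `μ` is not
absolutely continuous w.r.t. `π`). -/
def relEnt {X : Type*} [MeasurableSpace X] (μ base : Measure X) : EReal :=
  if μ ≪ base then
    ((∫⁻ x, ENNReal.ofReal (Real.log ((μ.rnDeriv base x).toReal)) ∂μ : ℝ≥0∞) : EReal)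
      - ((∫⁻ x, ENNReal.ofReal (-Real.log ((μ.rnDeriv base x).toReal)) ∂μ : ℝ≥0∞) : EReal)
  else ⊤

/-- The uniform probability measure on `(−1,1)`. -/
def unif11 : Measure Int11 := (2⁻¹ : ℝ≥0∞) • Measure.comap Subtype.val volume

/-- Empirical versions of `Q, M, A, E` for `m ∈ ℝⁿ`. -/
def Qf {n : ℕ} (m : Fin n → ℝ) : ℝ := (∑ i, (m i) ^ 2) / n

def Mf {n : ℕ} (m : Fin n → ℝ) : ℝ := (∑ i, m i) / n

def Af {n : ℕ} (m : Fin n → ℝ) : ℝ := (∑ i, m i * atanh (m i)) / n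

def Ef {n : ℕ} (β : ℝ) (m : Fin n → ℝ) : ℝ :=
  -(∑ i, (ent (m i) + m i * atanh (m i) / 2)) / n - β ^ 2 / 4 * (1 - (Qf m) ^ 2)

/-- `J(m, y)` for a vector `m`. -/
def Jf {n : ℕ} (β lam : ℝ) (m : Fin n → ℝ) (y : ℝ) : ℝ :=
  β ^ 2 * (1 - Qf m) ^ 2 / 2 - Real.log (2 * π * β ^ 2 * Qf m) / 2
    + (∑ i, Real.log (gdens β lam (m i) (Mf m) (Qf m) y)) / n

/-- `T(U, V_n)`. -/
def Tval (n : ℕ) (β lam C₀ b : ℝ) (U : Set (ℝ × ℝ × ℝ × ℝ)) : ℝ≥0∞ :=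
  ENNReal.ofReal (Real.sqrt (n / (2 * π * β ^ 2))) *
    ∫⁻ m in Set.pi Set.univ (fun _ : Fin n => Set.Ioo (-1 : ℝ) 1), ∫⁻ y : ℝ,
      (if (Qf m, Mf m, Af m, Ef β m) ∈ U then
        ENNReal.ofReal (Real.exp (n * Jf β lam m y - n * y ^ 2 / (2 * β ^ 2)
          + C₀ * (n : ℝ) ^ max 0.9 b))
      else 0)

section

open InformationTheory Topology

/-- A quantitative midpoint convexity of `klFun` in terms of the Hellinger distance. -/
lemma klFun_midpoint_add_le {a b : ℝ} (ha : 0 ≤ a) (hb : 0 ≤ b) :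
    2 * klFun ((a + b) / 2) + (√a - √b) ^ 2 / 2 ≤ klFun a + klFun b := by
  rcases (add_nonneg ha hb).eq_or_lt with h0 | h0
  · obtain rfl : a = 0 := by linarith
    obtain rfl : b = 0 := by linarith
    simp [klFun]; norm_num
  set c := (a + b) / 2 with hc
  have hcpos : 0 < c := by linarith
  have key : ∀ x : ℝ, 0 ≤ x → 2 * (x - √x * √c) ≤ x * (log x - log c) := by
    intro x hx
    rcases hx.eq_or_lt with rfl | hx
    · simp
    have h1 : log (√c / √x) ≤ √c / √x - 1 :=
      log_le_sub_one_of_pos (by positivity)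
    rw [log_div (by positivity) (by positivity), log_sqrt hcpos.le, log_sqrt hx.le] at h1
    have h2 : x * (√c / √x) = √x * √c := by
      have : √x ≠ 0 := by positivity
      field_simp
      rw [sq_sqrt hx.le]
    nlinarith [mul_le_mul_of_nonneg_left h1 hx.le]
  have k1 := key a ha
  have k2 := key b hb
  have e : 2 * klFun c = (a + b) * log c + 2 - (a + b) := by
    simp only [klFun]; rw [hc]; ring
  rw [e]
  simp only [klFun]
  have sa := sq_sqrt ha
  have sb := sq_sqrt hb
  have sc := sq_sqrt hcpos.le
  nlinarith [sq_nonneg (√a + √b - 2 * √c)]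

/-- A version of Fatou's lemma for real integrals. -/
lemma integrable_and_integral_le_of_tendsto {X : Type*} [MeasurableSpace X] {μ : Measure X}
    {f : ℕ → X → ℝ} {g : X → ℝ} {a : ℕ → ℝ} {c : ℝ}
    (hf : ∀ n, Integrable (f n) μ) (hf0 : ∀ n, 0 ≤ᵐ[μ] f n)
    (hfg : ∀ᵐ x ∂μ, Tendsto (fun n => f n x) atTop (𝓝 (g x)))
    (ha : ∀ n, ∫ x, f n x ∂μ ≤ a n) (hac : Tendsto a atTop (𝓝 c)) :
    Integrable g μ ∧ ∫ x, g x ∂μ ≤ c := by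
  have hg0 : 0 ≤ᵐ[μ] g := by
    filter_upwards [hfg, ae_all_iff.2 hf0] with x hx h0
    exact ge_of_tendsto' hx h0
  have hgm : AEStronglyMeasurable g μ :=
    aestronglyMeasurable_of_tendsto_ae atTop (fun n => (hf n).aestronglyMeasurable) hfg
  have hc0 : 0 ≤ c := ge_of_tendsto' hac fun n => (integral_nonneg_of_ae (hf0 n)).trans (ha n)
  have key : ∫⁻ x, ENNReal.ofReal (g x) ∂μ ≤ ENNReal.ofReal c := by
    calc ∫⁻ x, ENNReal.ofReal (g x) ∂μ
        = ∫⁻ x, liminf (fun n => ENNReal.ofReal (f n x)) atTop ∂μ := by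
          refine lintegral_congr_ae ?_
          filter_upwards [hfg] with x hx
          exact ((ENNReal.continuous_ofReal.tendsto _).comp hx).liminf_eq.symm
      _ ≤ liminf (fun n => ∫⁻ x, ENNReal.ofReal (f n x) ∂μ) atTop :=
          lintegral_liminf_le' fun n => (hf n).aestronglyMeasurable.aemeasurable.ennreal_ofReal
      _ ≤ liminf (fun n => ENNReal.ofReal (a n)) atTop := by
          refine liminf_le_liminf (Eventually.of_forall fun n => ?_)
          rw [← ofReal_integral_eq_lintegral_ofReal (hf n) (hf0 n)]
          exact ENNReal.ofReal_le_ofReal (ha n)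
      _ = ENNReal.ofReal c := ((ENNReal.continuous_ofReal.tendsto _).comp hac).liminf_eq
  have hgi : Integrable g μ := by
    refine ⟨hgm, ?_⟩
    rw [hasFiniteIntegral_iff_ofReal hg0]
    exact key.trans_lt ENNReal.ofReal_lt_top
  refine ⟨hgi, ?_⟩
  rw [← ofReal_integral_eq_lintegral_ofReal hgi hg0] at key
  exact (ENNReal.ofReal_le_ofReal_iff hc0).1 key

/-- `D` is a probability density with respect to `μ` whose `S`-moments are within `δ` of `s`, and
whose `w`-moment is at most `t + δ`. -/
structure IsMomentDensity {X ι : Type*} [MeasurableSpace X] (μ : Measure X) (S : ι → X → ℝ)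
    (w : X → ℝ) (s : ι → ℝ) (t δ : ℝ) (D : X → ℝ) : Prop where
  measurable : Measurable D
  nonneg : ∀ x, 0 ≤ D x
  integrable : Integrable D μ
  integral_eq_one : ∫ x, D x ∂μ = 1
  integrable_weight : Integrable (fun x => w x * D x) μ
  integral_weight_le : ∫ x, w x * D x ∂μ ≤ t + δ
  abs_integral_sub_le : ∀ k, |∫ x, S k x * D x ∂μ - s k| ≤ δ

lemma integrable_mul_of_le_weight {X : Type*} [MeasurableSpace X] {μ : Measure X} {f w D : X → ℝ}
    (hfm : Measurable f) (hDm : Measurable D) {ε C : ℝ} (hf : ∀ᵐ x ∂μ, |f x| ≤ ε * w x + C)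
    (hD0 : ∀ x, 0 ≤ D x) (hD : Integrable D μ) (hw : Integrable (fun x => w x * D x) μ) :
    Integrable (fun x => f x * D x) μ := by
  refine ((hw.const_mul ε).add (hD.const_mul C)).mono' (hfm.mul hDm).aestronglyMeasurable ?_
  filter_upwards [hf] with x hx
  rw [norm_eq_abs, abs_mul, abs_of_nonneg (hD0 x)]
  simp only [Pi.add_apply]
  nlinarith [mul_le_mul_of_nonneg_right hx (hD0 x)]

section

variable {X ι : Type*} [MeasurableSpace X] {μ : Measure X} {S : ι → X → ℝ} {w : X → ℝ}
  {s : ι → ℝ} {t : ℝ}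

lemma IsMomentDensity.mono {δ δ' : ℝ} {D : X → ℝ} (h : IsMomentDensity μ S w s t δ D)
    (hδ : δ ≤ δ') : IsMomentDensity μ S w s t δ' D where
  measurable := h.measurable
  nonneg := h.nonneg
  integrable := h.integrable
  integral_eq_one := h.integral_eq_one
  integrable_weight := h.integrable_weight
  integral_weight_le := h.integral_weight_le.trans (by linarith)
  abs_integral_sub_le k := (h.abs_integral_sub_le k).trans hδ

lemma IsMomentDensity.midpoint (hS : ∀ k, Measurable (S k))
    (hSw : ∀ k, ∀ ε > 0, ∃ C, ∀ᵐ x ∂μ, |S k x| ≤ ε * w x + C) {δ : ℝ} {D D' : X → ℝ}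
    (h : IsMomentDensity μ S w s t δ D) (h' : IsMomentDensity μ S w s t δ D') :
    IsMomentDensity μ S w s t δ (fun x => (D x + D' x) / 2) where
  measurable := (h.measurable.add h'.measurable).div_const 2
  nonneg x := by linarith [h.nonneg x, h'.nonneg x]
  integrable := (h.integrable.add h'.integrable).div_const 2
  integral_eq_one := by
    rw [integral_div, integral_add h.integrable h'.integrable, h.integral_eq_one,
      h'.integral_eq_one]
    norm_num
  integrable_weight := by
    refine ((h.integrable_weight.add h'.integrable_weight).div_const 2).congr
      (Eventually.of_forall fun x => ?_)
    simp only [Pi.add_apply]; ring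
  integral_weight_le := by
    have : ∀ x, w x * ((D x + D' x) / 2) = (w x * D x + w x * D' x) / 2 := fun x => by ring
    simp_rw [this]
    rw [integral_div, integral_add h.integrable_weight h'.integrable_weight]
    linarith [h.integral_weight_le, h'.integral_weight_le]
  abs_integral_sub_le k := by
    obtain ⟨C, hC⟩ := hSw k 1 one_pos
    have i1 := integrable_mul_of_le_weight (hS k) h.measurable hC h.nonneg h.integrable
      h.integrable_weight
    have i2 := integrable_mul_of_le_weight (hS k) h'.measurable hC h'.nonneg h'.integrable
      h'.integrable_weight
    have : ∀ x, S k x * ((D x + D' x) / 2) = (S k x * D x + S k x * D' x) / 2 := fun x => by ring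
    simp_rw [this]
    rw [integral_div, integral_add i1 i2]
    have a1 := abs_le.1 (h.abs_integral_sub_le k)
    have a2 := abs_le.1 (h'.abs_integral_sub_le k)
    rw [abs_le]
    constructor <;> linarith [a1.1, a1.2, a2.1, a2.2]

/-- Densities with almost the right moments and bounded entropy that converge almost everywhere and
in total mass produce a density with exactly the right moments. -/
lemma IsMomentDensity.of_tendsto (hS : ∀ k, Measurable (S k))
    (hSw : ∀ k, ∀ ε > 0, ∃ C, ∀ᵐ x ∂μ, |S k x| ≤ ε * w x + C) (hw0 : ∀ x, 0 ≤ w x)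
    {δ : ℕ → ℝ} (hδ : Tendsto δ atTop (𝓝 0)) {D : ℕ → X → ℝ} {g : X → ℝ}
    (hD : ∀ n, IsMomentDensity μ S w s t (δ n) (D n)) (hgm : Measurable g) (hg0 : ∀ x, 0 ≤ g x)
    (hg1 : ∫ x, g x ∂μ = 1) (hlim : ∀ᵐ x ∂μ, Tendsto (fun n => D n x) atTop (𝓝 (g x))) :
    IsMomentDensity μ S w s t 0 g := by
  have hgi : Integrable g μ := by
    by_contra h
    rw [integral_undef h] at hg1
    exact zero_ne_one hg1
  have htδ : Tendsto (fun n => t + δ n) atTop (𝓝 t) := by simpa using hδ.const_add t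
  obtain ⟨hwi, hwt⟩ := integrable_and_integral_le_of_tendsto (fun n => (hD n).integrable_weight)
    (fun n => Eventually.of_forall fun x => mul_nonneg (hw0 x) ((hD n).nonneg x))
    (by filter_upwards [hlim] with x hx using hx.const_mul (w x))
    (fun n => (hD n).integral_weight_le) htδ
  have bound : ∀ (f : X → ℝ) (c : ℝ), Measurable f →
      (∀ ε > 0, ∃ C, ∀ᵐ x ∂μ, |f x| ≤ ε * w x + C) →
      (∀ n, ∫ x, f x * D n x ∂μ ≤ c + δ n) → ∫ x, f x * g x ∂μ ≤ c := by
    intro f c hfm hfw hfD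
    have ht0 : 0 ≤ t := (integral_nonneg fun x => mul_nonneg (hw0 x) (hg0 x)).trans hwt
    refine le_of_forall_pos_le_add fun ε hε => ?_
    set ε' := ε / (t + 1) with hε'
    have hε'0 : 0 < ε' := by positivity
    obtain ⟨C, hC⟩ := hfw ε' hε'0
    have hfi := fun n => integrable_mul_of_le_weight hfm (hD n).measurable hC (hD n).nonneg
      (hD n).integrable (hD n).integrable_weight
    have hfgi := integrable_mul_of_le_weight hfm hgm hC hg0 hgi hwi
    have eq : ∀ E : X → ℝ, Integrable E μ → Integrable (fun x => w x * E x) μ →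
        Integrable (fun x => f x * E x) μ → ∫ x, E x ∂μ = 1 →
        Integrable (fun x => f x * E x + ε' * (w x * E x) + C * E x) μ ∧
        ∫ x, (f x * E x + ε' * (w x * E x) + C * E x) ∂μ
          = ∫ x, f x * E x ∂μ + ε' * ∫ x, w x * E x ∂μ + C := by
      intro E h1 h2 h3 h4
      have i2 := h2.const_mul ε'
      have i1 := h1.const_mul C
      have i3 : Integrable (fun x => f x * E x + ε' * (w x * E x)) μ := h3.add i2
      refine ⟨i3.add i1, ?_⟩
      rw [integral_add i3 i1, integral_add h3 i2, integral_const_mul,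
        integral_const_mul, h4, mul_one]
    have eD := fun n => eq (D n) (hD n).integrable (hD n).integrable_weight (hfi n)
      (hD n).integral_eq_one
    have eg := eq g hgi hwi hfgi hg1
    obtain ⟨-, h⟩ := integrable_and_integral_le_of_tendsto
      (g := fun x => f x * g x + ε' * (w x * g x) + C * g x)
      (a := fun n => (c + δ n) + ε' * (t + δ n) + C) (c := c + ε' * t + C) (fun n => (eD n).1)
      (fun n => by
        filter_upwards [hC] with x hx
        have := mul_nonneg (by linarith [(abs_le.1 hx).1] : 0 ≤ f x + ε' * w x + C)
          ((hD n).nonneg x)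
        simp only [Pi.zero_apply]
        linarith)
      (by
        filter_upwards [hlim] with x hx
        exact ((hx.const_mul _).add ((hx.const_mul _).const_mul _)).add (hx.const_mul _))
      (fun n => by
        rw [(eD n).2]
        nlinarith [hfD n, (hD n).integral_weight_le])
      (by
        have := ((hδ.const_add c).add (htδ.const_mul ε')).add_const C
        simpa using this)
    rw [eg.2] at h
    have hwg : 0 ≤ ∫ x, w x * g x ∂μ := integral_nonneg fun x => mul_nonneg (hw0 x) (hg0 x)
    have : ε' * t ≤ ε := by
      rw [hε', div_mul_eq_mul_div, div_le_iff₀ (by positivity)]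
      nlinarith
    nlinarith
  refine ⟨hgm, hg0, hgi, hg1, hwi, by simpa using hwt, fun k => ?_⟩
  have u := bound (S k) (s k) (hS k) (hSw k) fun n => by
    linarith [(abs_le.1 ((hD n).abs_integral_sub_le k)).2]
  have l := bound (fun x => -S k x) (-s k) (hS k).neg
    (fun ε hε => by simpa only [abs_neg] using hSw k ε hε) fun n => by
    simp_rw [neg_mul]
    rw [integral_neg]
    linarith [(abs_le.1 ((hD n).abs_integral_sub_le k)).1]
  simp_rw [neg_mul] at l
  rw [integral_neg] at l
  rw [abs_le]
  constructor <;> linarith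

end

lemma L2_norm_sq_eq_integral {X : Type*} [MeasurableSpace X] {μ : Measure X} (f : Lp ℝ 2 μ) :
    ‖f‖ ^ 2 = ∫ x, (f x) ^ 2 ∂μ := by
  rw [← real_inner_self_eq_norm_sq, L2.inner_def]
  simp [sq]

section

variable {X ι : Type*} [MeasurableSpace X] {μ : Measure X} {S : ι → X → ℝ} {w : X → ℝ}
  {s : ι → ℝ} {t : ℝ}

lemma IsMomentDensity.memLp_sqrt {δ : ℝ} {D : X → ℝ} (h : IsMomentDensity μ S w s t δ D) :
    MemLp (fun x => √(D x)) 2 μ := by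
  rw [memLp_two_iff_integrable_sq h.measurable.sqrt.aestronglyMeasurable]
  simp_rw [sq_sqrt (h.nonneg _)]
  exact h.integrable

/-- The Hellinger distance of two densities is controlled by their entropies and the least entropy
`r` of a density subject to the same moment constraints. -/
lemma IsMomentDensity.integral_sqrt_sub_sq_le (hS : ∀ k, Measurable (S k))
    (hSw : ∀ k, ∀ ε > 0, ∃ C, ∀ᵐ x ∂μ, |S k x| ≤ ε * w x + C) {δ r : ℝ} {D D' : X → ℝ}
    (h : IsMomentDensity μ S w s t δ D) (h' : IsMomentDensity μ S w s t δ D')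
    (hk : Integrable (fun x => klFun (D x)) μ) (hk' : Integrable (fun x => klFun (D' x)) μ)
    (hr : ∀ E, IsMomentDensity μ S w s t δ E → Integrable (fun x => klFun (E x)) μ →
      r ≤ ∫ x, klFun (E x) ∂μ) :
    ∫ x, (√(D x) - √(D' x)) ^ 2 ∂μ
      ≤ 2 * (∫ x, klFun (D x) ∂μ + ∫ x, klFun (D' x) ∂μ - 2 * r) := by
  have hm := h.midpoint hS hSw h'
  have hpt := fun x => klFun_midpoint_add_le (h.nonneg x) (h'.nonneg x)
  have hkm : Integrable (fun x => klFun ((D x + D' x) / 2)) μ := by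
    refine (hk.add hk').mono' (measurable_klFun.comp hm.measurable).aestronglyMeasurable
      (Eventually.of_forall fun x => ?_)
    have h0 := klFun_nonneg (hm.nonneg x)
    rw [norm_eq_abs, abs_of_nonneg h0]
    simp only [Pi.add_apply]
    nlinarith [hpt x, sq_nonneg (√(D x) - √(D' x))]
  have hsq : Integrable (fun x => (√(D x) - √(D' x)) ^ 2) μ :=
    (h.memLp_sqrt.sub h'.memLp_sqrt).integrable_sq
  have hsum : ∫ x, (2 * klFun ((D x + D' x) / 2) + (√(D x) - √(D' x)) ^ 2 / 2) ∂μ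
      ≤ ∫ x, (klFun (D x) + klFun (D' x)) ∂μ :=
    integral_mono ((hkm.const_mul 2).add (hsq.div_const 2)) (hk.add hk') hpt
  rw [integral_add (hkm.const_mul 2) (hsq.div_const 2), integral_const_mul, integral_div,
    integral_add hk hk'] at hsum
  have := hr _ hm hkm
  linarith

/-- Moment constraints can be attained exactly without raising the entropy if they can be attained
approximately. -/
theorem exists_isMomentDensity_of_forall_pos (hS : ∀ k, Measurable (S k))
    (hSw : ∀ k, ∀ ε > 0, ∃ C, ∀ᵐ x ∂μ, |S k x| ≤ ε * w x + C) (hw0 : ∀ x, 0 ≤ w x) {c : ℝ}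
    (h : ∀ δ > 0, ∃ D, IsMomentDensity μ S w s t δ D ∧ Integrable (fun x => klFun (D x)) μ ∧
      ∫ x, klFun (D x) ∂μ ≤ c) :
    ∃ D, IsMomentDensity μ S w s t 0 D ∧ Integrable (fun x => klFun (D x)) μ ∧
      ∫ x, klFun (D x) ∂μ ≤ c := by
  set δ : ℕ → ℝ := fun j => 1 / ((j : ℝ) + 1) with hδ
  have hδ0 : ∀ j, 0 < δ j := fun j => Nat.one_div_pos_of_nat
  have hδlim : Tendsto δ atTop (𝓝 0) := tendsto_one_div_add_atTop_nhds_zero_nat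
  have hδanti : Antitone δ := fun i j hij => Nat.one_div_le_one_div hij
  set A : ℕ → Set ℝ := fun j => {r | ∃ D, IsMomentDensity μ S w s t (δ j) D ∧
    Integrable (fun x => klFun (D x)) μ ∧ ∫ x, klFun (D x) ∂μ = r} with hA
  have hAb : ∀ j, BddBelow (A j) := by
    refine fun j => ⟨0, ?_⟩
    rintro r ⟨D, hD, -, rfl⟩
    exact integral_nonneg fun x => klFun_nonneg (hD.nonneg x)
  have hAne : ∀ j, (A j).Nonempty := by
    intro j
    obtain ⟨D, hD, hk, -⟩ := h (δ j) (hδ0 j)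
    exact ⟨_, D, hD, hk, rfl⟩
  set H : ℕ → ℝ := fun j => sInf (A j) with hH
  have hHle : ∀ j D, IsMomentDensity μ S w s t (δ j) D → Integrable (fun x => klFun (D x)) μ →
      H j ≤ ∫ x, klFun (D x) ∂μ := fun j D hD hk => csInf_le (hAb j) ⟨D, hD, hk, rfl⟩
  have hHc : ∀ j, H j ≤ c := by
    intro j
    obtain ⟨D, hD, hk, hDc⟩ := h (δ j) (hδ0 j)
    exact (hHle j D hD hk).trans hDc
  have hHmono : Monotone H := by
    intro i j hij
    refine csInf_le_csInf (hAb i) (hAne j) ?_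
    rintro r ⟨D, hD, hk, rfl⟩
    exact ⟨D, hD.mono (hδanti hij), hk, rfl⟩
  have hHbdd : BddAbove (Set.range H) := ⟨c, by rintro _ ⟨j, rfl⟩; exact hHc j⟩
  set L := ⨆ j, H j with hL
  have hHlim : Tendsto H atTop (𝓝 L) := tendsto_atTop_ciSup hHmono hHbdd
  have hHL : ∀ j, H j ≤ L := fun j => le_ciSup hHbdd j
  have hex : ∀ j, ∃ D, IsMomentDensity μ S w s t (δ j) D ∧
      Integrable (fun x => klFun (D x)) μ ∧ ∫ x, klFun (D x) ∂μ ≤ H j + δ j := by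
    intro j
    obtain ⟨r, ⟨D, hD, hk, rfl⟩, hlt⟩ := exists_lt_of_csInf_lt (hAne j)
      (lt_add_of_pos_right (sInf (A j)) (hδ0 j))
    exact ⟨D, hD, hk, hlt.le⟩
  choose D hD hk hDH using hex
  set F : ℕ → Lp ℝ 2 μ := fun j => (hD j).memLp_sqrt.toLp _ with hF
  have hFdist : ∀ i j, i ≤ j → dist (F i) (F j) ≤ √(2 * (L - H i + 2 * δ i)) := by
    intro i j hij
    apply le_sqrt_of_sq_le
    rw [dist_eq_norm, hF, ← MemLp.toLp_sub, L2_norm_sq_eq_integral]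
    have e : ∫ x, (((hD i).memLp_sqrt.sub (hD j).memLp_sqrt).toLp _ x) ^ 2 ∂μ
        = ∫ x, (√(D i x) - √(D j x)) ^ 2 ∂μ := by
      refine integral_congr_ae ?_
      filter_upwards [((hD i).memLp_sqrt.sub (hD j).memLp_sqrt).coeFn_toLp] with x hx
      rw [hx]; simp
    rw [e]
    refine ((hD i).integral_sqrt_sub_sq_le hS hSw ((hD j).mono (hδanti hij)) (hk i) (hk j)
      (hHle i)).trans ?_
    linarith [hDH i, hDH j, hHL j, hδanti hij]
  have hb : Tendsto (fun N => √(2 * (L - H N + 2 * δ N))) atTop (𝓝 0) := by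
    have : Tendsto (fun N => √(2 * (L - H N + 2 * δ N))) atTop (𝓝 √(2 * (L - L + 2 * 0))) :=
      (continuous_sqrt.tendsto _).comp
        (((hHlim.const_sub L).add (hδlim.const_mul 2)).const_mul 2)
    simpa using this
  have hcau : CauchySeq F := by
    refine cauchySeq_of_le_tendsto_0' _ hFdist hb
  obtain ⟨G, hG⟩ := cauchySeq_tendsto_of_complete hcau
  obtain ⟨ns, hns, hae⟩ := (tendstoInMeasure_of_tendsto_Lp hG).exists_seq_tendsto_ae
  have hGm : Measurable (fun x => (G x) ^ 2) := (Lp.stronglyMeasurable G).measurable.pow_const 2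
  have hlim : ∀ᵐ x ∂μ, Tendsto (fun n => D (ns n) x) atTop (𝓝 ((G x) ^ 2)) := by
    have : ∀ᵐ x ∂μ, ∀ j, F j x = √(D j x) := ae_all_iff.2 fun j => (hD j).memLp_sqrt.coeFn_toLp
    filter_upwards [hae, this] with x hx hx'
    refine (hx.pow 2).congr fun n => ?_
    rw [hx', sq_sqrt ((hD _).nonneg x)]
  have hF1 : ∀ j, ‖F j‖ ^ 2 = 1 := by
    intro j
    rw [L2_norm_sq_eq_integral, ← (hD j).integral_eq_one]
    refine integral_congr_ae ?_
    filter_upwards [(hD j).memLp_sqrt.coeFn_toLp] with x hx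
    rw [hx, sq_sqrt ((hD _).nonneg x)]
  have hG1 : ∫ x, (G x) ^ 2 ∂μ = 1 := by
    rw [← L2_norm_sq_eq_integral]
    refine tendsto_nhds_unique ((hG.norm).pow 2) ?_
    simp_rw [hF1]
    exact tendsto_const_nhds
  refine ⟨_, IsMomentDensity.of_tendsto hS hSw hw0 (hδlim.comp hns.tendsto_atTop)
    (fun n => hD (ns n)) hGm (fun x => sq_nonneg _) hG1 hlim, ?_⟩
  refine integrable_and_integral_le_of_tendsto (fun n => hk (ns n))
    (fun n => Eventually.of_forall fun x => klFun_nonneg ((hD _).nonneg x)) ?_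
    (a := fun n => c + δ (ns n)) (fun n => (hDH _).trans (by linarith [hHc (ns n)])) ?_
  · filter_upwards [hlim] with x hx
    exact (continuous_klFun.tendsto _).comp hx
  · simpa using (hδlim.comp hns.tendsto_atTop).const_add c

end

lemma integrable_comp_of_continuousOn_Icc {X : Type*} [MeasurableSpace X] {μ : Measure X}
    [IsFiniteMeasure μ] {D : X → ℝ} {φ : ℝ → ℝ} {a b : ℝ} (hD : Measurable D)
    (hφm : Measurable φ) (hφ : ContinuousOn φ (Set.Icc a b)) (hab : ∀ x, D x ∈ Set.Icc a b) :
    Integrable (fun x => φ (D x)) μ := by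
  obtain ⟨K, hK⟩ := isCompact_Icc.exists_bound_of_continuousOn hφ
  exact Integrable.of_bound (hφm.comp hD).aestronglyMeasurable K
    (Eventually.of_forall fun x => hK _ (hab x))

/-- The average of the one-dimensional marginals of a measure on a power. -/
def avgMarginal {X : Type*} [MeasurableSpace X] {n : ℕ} (P : Measure (Fin n → X)) : Measure X :=
  (n : ℝ≥0∞)⁻¹ • ∑ i, P.map (fun x => x i)

section

variable {X : Type*} [MeasurableSpace X] {n : ℕ} {P : Measure (Fin n → X)}

lemma isProbabilityMeasure_avgMarginal (hn : 0 < n) [IsProbabilityMeasure P] :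
    IsProbabilityMeasure (avgMarginal P) := by
  constructor
  have : ∀ i : Fin n, (P.map (fun x => x i)) Set.univ = 1 := fun i => by
    rw [Measure.map_apply (measurable_pi_apply i) MeasurableSet.univ]; simp
  simp only [avgMarginal, Measure.smul_apply, Measure.finsetSum_apply, this, Finset.sum_const,
    Finset.card_univ, Fintype.card_fin, nsmul_eq_mul, mul_one, smul_eq_mul]
  exact ENNReal.inv_mul_cancel (by simpa using hn.ne') (by simp)

lemma integral_avgMarginal {f : X → ℝ} (hf : Measurable f)
    (hi : ∀ i, Integrable (fun x => f (x i)) P) (hn : 0 < n) :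
    Integrable f (avgMarginal P) ∧
      ∫ x, f x ∂(avgMarginal P) = ∫ x, (∑ i, f (x i)) / n ∂P := by
  have hmap : ∀ i, Integrable f (P.map (fun x => x i)) := fun i =>
    (integrable_map_measure hf.aestronglyMeasurable (measurable_pi_apply i).aemeasurable).2 (hi i)
  have hsum : Integrable f (∑ i, P.map (fun x => x i)) :=
    integrable_finsetSum_measure.2 fun i _ => hmap i
  refine ⟨hsum.smul_measure (by simpa using hn.ne'), ?_⟩
  rw [avgMarginal, integral_smul_measure, integral_finsetSum_measure fun i _ => hmap i,
    integral_div, integral_finsetSum _ fun i _ => hi i]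
  have : ∀ i, ∫ x, f x ∂(P.map (fun x => x i)) = ∫ x, f (x i) ∂P := fun i =>
    integral_map (measurable_pi_apply i).aemeasurable hf.aestronglyMeasurable
  simp [this, div_eq_inv_mul]

lemma avgMarginal_le (hn : 0 < n) {μ : Measure X} {c : ℝ≥0∞}
    (h : ∀ i, P.map (fun x => x i) ≤ c • μ) : avgMarginal P ≤ c • μ := by
  refine Measure.le_iff.2 fun A hA => ?_
  simp only [avgMarginal, Measure.smul_apply, Measure.finsetSum_apply, smul_eq_mul]
  calc (n : ℝ≥0∞)⁻¹ * ∑ i, (P.map (fun x => x i)) A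
      ≤ (n : ℝ≥0∞)⁻¹ * ∑ _i : Fin n, c * μ A := by
        gcongr with i _
        exact h i A
    _ = c * μ A := by
        simp only [Finset.sum_const, Finset.card_univ, Fintype.card_fin, nsmul_eq_mul]
        rw [← mul_assoc, ENNReal.inv_mul_cancel (by simpa using hn.ne') (by simp), one_mul]

end

/-- **Sanov-type upper bound for moment constraints.** If the empirical moments of `n` independent
samples satisfy the constraints with probability `p > 0`, then the constraints hold for a density of
entropy at most `-log p / n`. -/
theorem exists_isMomentDensity_of_pi_pos {X ι : Type*} [MeasurableSpace X] [Countable ι]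
    {μ : Measure X} [IsProbabilityMeasure μ] {S : ι → X → ℝ} {w : X → ℝ} {s : ι → ℝ} {t δ : ℝ}
    (hS : ∀ k, Measurable (S k)) (hw : Measurable w)
    (hSw : ∀ k, ∃ C, ∀ᵐ x ∂μ, |S k x| ≤ w x + C) (hw0 : ∀ x, 0 ≤ w x) {n : ℕ} (hn : 0 < n)
    {B : Set (Fin n → X)} (hB : B = {x | (∀ k, |(∑ i, S k (x i)) / n - s k| ≤ δ) ∧
      (∑ i, w (x i)) / n ≤ t + δ}) (hpos : Measure.pi (fun _ => μ) B ≠ 0) :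
    ∃ D, IsMomentDensity μ S w s t δ D ∧ Integrable (fun x => klFun (D x)) μ ∧
      ∫ x, klFun (D x) ∂μ ≤ -log ((Measure.pi (fun _ : Fin n => μ)).real B) / n := by
  set ν := Measure.pi (fun _ : Fin n => μ) with hν
  have hn' : (0 : ℝ) < n := by exact_mod_cast hn
  have hBm : MeasurableSet B := by
    rw [hB]
    refine MeasurableSet.inter (?_ : MeasurableSet {x | ∀ k, _}) (?_ : MeasurableSet {x | _})
    · rw [Set.ofPred_forall]
      refine MeasurableSet.iInter fun k => measurableSet_le (α := ℝ) ?_ measurable_const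
      have := hS k
      fun_prop
    · refine measurableSet_le (α := ℝ) ?_ measurable_const
      fun_prop
  set P := ν[|B] with hP
  have : IsProbabilityMeasure P := cond_isProbabilityMeasure hpos
  have hPB : ∀ᵐ x ∂P, x ∈ B := ae_cond_mem hBm
  have := isProbabilityMeasure_avgMarginal hn (P := P)
  set ρ := avgMarginal P with hρ
  set p := ν.real B with hp
  have hp0 : 0 < p := ENNReal.toReal_pos hpos (measure_ne_top _ _)
  have hmarg : ∀ i, P.map (fun x => x i) ≤ (ν B)⁻¹ • μ := by
    refine fun i => Measure.le_iff.2 fun A hA => ?_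
    rw [Measure.map_apply (measurable_pi_apply i) hA, hP, cond_apply hBm]
    simp only [Measure.smul_apply, smul_eq_mul]
    gcongr
    calc ν (B ∩ (fun x => x i) ⁻¹' A) ≤ ν ((fun x => x i) ⁻¹' A) :=
          measure_mono Set.inter_subset_right
      _ = μ A := (measurePreserving_eval (fun _ => μ) i).measure_preimage hA.nullMeasurableSet
  have hinv_top : (ν B)⁻¹ ≠ ∞ := ENNReal.inv_ne_top.2 hpos
  have hρle : ρ ≤ (ν B)⁻¹ • μ := avgMarginal_le hn hmarg
  have hac : ρ ≪ μ := hρle.absolutelyContinuous.trans Measure.smul_absolutelyContinuous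
  have hmargac : ∀ i, P.map (fun x => x i) ≪ μ := fun i =>
    (hmarg i).absolutelyContinuous.trans Measure.smul_absolutelyContinuous
  have hrn : ∀ᵐ x ∂μ, ρ.rnDeriv μ x ≤ (ν B)⁻¹ := by
    refine ae_le_of_forall_setLIntegral_le_of_sigmaFinite (Measure.measurable_rnDeriv _ _)
      fun A hA _ => ?_
    rw [setLIntegral_const]
    exact (Measure.setLIntegral_rnDeriv_le _).trans (hρle A)
  have hpinv : (ν B)⁻¹.toReal = p⁻¹ := ENNReal.toReal_inv _
  set D : X → ℝ := fun x => min (ρ.rnDeriv μ x).toReal p⁻¹ with hD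
  have hDae : D =ᵐ[μ] fun x => (ρ.rnDeriv μ x).toReal := by
    filter_upwards [hrn] with x hx
    refine min_eq_left ?_
    rw [← hpinv]
    exact ENNReal.toReal_mono hinv_top hx
  have hDm : Measurable D := (Measure.measurable_rnDeriv _ _).ennreal_toReal.min measurable_const
  have hDIcc : ∀ x, D x ∈ Set.Icc 0 p⁻¹ := fun x =>
    ⟨le_min ENNReal.toReal_nonneg (by positivity), min_le_right _ _⟩
  have hDint : ∀ f : X → ℝ, ∫ x, f x * D x ∂μ = ∫ x, f x ∂ρ := by
    intro f
    rw [← integral_toReal_rnDeriv_mul hac]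
    refine integral_congr_ae ?_
    filter_upwards [hDae] with x hx
    rw [hx, mul_comm]
  have hDi : Integrable D μ := integrable_comp_of_continuousOn_Icc (φ := id) hDm measurable_id
    continuousOn_id hDIcc
  have hD1 : ∫ x, D x ∂μ = 1 := by
    have := hDint (fun _ => 1)
    simpa using this
  have hwi : ∀ i, Integrable (fun x : Fin n → X => w (x i)) P := by
    refine fun i => Integrable.of_bound (hw.comp (measurable_pi_apply i)).aestronglyMeasurable
      (n * (t + δ)) ?_
    filter_upwards [hPB] with x hx
    rw [hB] at hx
    have := hx.2
    rw [div_le_iff₀ hn'] at this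
    rw [norm_eq_abs, abs_of_nonneg (hw0 _)]
    have := Finset.single_le_sum (f := fun i => w (x i)) (fun j _ => hw0 (x j)) (Finset.mem_univ i)
    linarith
  obtain ⟨hwρ, hwint⟩ := integral_avgMarginal hw hwi hn
  have hwD : Integrable (fun x => w x * D x) μ := by
    refine ((integrable_rnDeriv_smul_iff hac).2 hwρ).congr ?_
    filter_upwards [hDae] with x hx
    rw [hx, smul_eq_mul, mul_comm]
  have hSi : ∀ k i, Integrable (fun x : Fin n → X => S k (x i)) P := by
    intro k i
    obtain ⟨C, hC⟩ := hSw k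
    have hC' : ∀ᵐ x ∂P, |S k (x i)| ≤ w (x i) + C :=
      ae_of_ae_map (measurable_pi_apply i).aemeasurable ((hmargac i).ae_le hC)
    exact ((hwi i).add (integrable_const C)).mono'
      ((hS k).comp (measurable_pi_apply i)).aestronglyMeasurable hC'
  refine ⟨D, ⟨hDm, fun x => (hDIcc x).1, hDi, hD1, hwD, ?_, ?_⟩, ?_, ?_⟩
  · rw [hDint, hwint]
    calc ∫ x, (∑ i, w (x i)) / n ∂P ≤ ∫ _x, (t + δ) ∂P := by
          refine integral_mono_ae ((integrable_finsetSum _ fun i _ => hwi i).div_const _)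
            (integrable_const _) ?_
          filter_upwards [hPB] with x hx
          rw [hB] at hx
          exact hx.2
      _ = t + δ := by simp
  · intro k
    have hi : Integrable (fun x : Fin n → X => (∑ i, S k (x i)) / n) P :=
      (integrable_finsetSum _ fun i _ => hSi k i).div_const _
    have e : ∫ x, (∑ i, S k (x i)) / n ∂P - s k = ∫ x, ((∑ i, S k (x i)) / n - s k) ∂P := by
      rw [integral_sub hi (integrable_const _)]; simp
    rw [hDint, (integral_avgMarginal (hS k) (hSi k) hn).2, e, ← norm_eq_abs]
    refine (norm_integral_le_of_norm_le_const (C := δ) ?_).trans (by simp)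
    filter_upwards [hPB] with x hx
    rw [hB] at hx
    exact hx.1 k
  · exact integrable_comp_of_continuousOn_Icc hDm measurable_klFun continuous_klFun.continuousOn
      hDIcc
  · have hlogD : Integrable (fun x => D x * log (D x)) μ :=
      integrable_comp_of_continuousOn_Icc (φ := fun y => y * log y) hDm (by fun_prop)
        continuous_mul_log.continuousOn hDIcc
    have hkl : ∫ x, klFun (D x) ∂μ = ∫ x, D x * log (D x) ∂μ := by
      simp only [klFun]
      have hlogD1 : Integrable (fun x => D x * log (D x) + 1) μ := hlogD.add (integrable_const 1)
      rw [integral_sub hlogD1 hDi,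
        integral_add hlogD (integrable_const 1), hD1]
      simp
    rw [hkl]
    refine le_of_forall_pos_le_add fun ε hε => ?_
    set f : X → ℝ := fun x => log (D x + ε) with hf
    have hfm : Measurable f := by fun_prop
    have hcont : ContinuousOn (fun y : ℝ => log (y + ε)) (Set.Icc 0 p⁻¹) :=
      ContinuousOn.log (by fun_prop) fun y hy => by linarith [hy.1]
    have hfi : ∀ i, Integrable (fun x : Fin n → X => f (x i)) P := fun i =>
      integrable_comp_of_continuousOn_Icc (φ := fun y => log (y + ε))
        (hDm.comp (measurable_pi_apply i)) (by fun_prop) hcont fun x => hDIcc (x i)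
    obtain ⟨-, hfint⟩ := integral_avgMarginal hfm hfi hn
    have hle : ∫ x, D x * log (D x) ∂μ ≤ ∫ x, f x ∂ρ := by
      rw [← hDint]
      refine integral_mono hlogD (integrable_comp_of_continuousOn_Icc
        (φ := fun y => log (y + ε) * y) hDm (by fun_prop) (hcont.mul continuousOn_id) hDIcc) ?_
      intro x
      simp only [hf]
      rcases (hDIcc x).1.eq_or_lt with h | h
      · simp [← h]
      · rw [mul_comm]
        gcongr
        linarith
    have hprod : ∀ x : Fin n → X, exp (∑ i, f (x i)) = ∏ i, (D (x i) + ε) := by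
      intro x
      rw [exp_sum]
      exact Finset.prod_congr rfl fun i _ => exp_log (by linarith [(hDIcc (x i)).1])
    have hprodi : Integrable (fun x : Fin n → X => ∏ i, (D (x i) + ε)) ν :=
      Integrable.fintype_prod (fun _ => hDi.add (integrable_const ε))
    have hprodP : Integrable (fun x : Fin n → X => ∏ i, (D (x i) + ε)) P := by
      rw [hP, ProbabilityTheory.cond]
      exact hprodi.restrict.smul_measure hinv_top
    have hjensen : exp (∫ x, ∑ i, f (x i) ∂P) ≤ p⁻¹ * (1 + ε) ^ n := by
      calc exp (∫ x, ∑ i, f (x i) ∂P) ≤ ∫ x, exp (∑ i, f (x i)) ∂P :=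
            convexOn_exp.map_integral_le continuous_exp.continuousOn isClosed_univ (by simp)
              (integrable_finsetSum _ fun i _ => hfi i) (by
                simp only [Function.comp_def, hprod]
                exact hprodP)
        _ = p⁻¹ * ∫ x in B, ∏ i, (D (x i) + ε) ∂ν := by
            simp_rw [hprod]
            rw [hP, ProbabilityTheory.cond, integral_smul_measure, hpinv, smul_eq_mul]
        _ ≤ p⁻¹ * ∫ x, ∏ i, (D (x i) + ε) ∂ν := by
            gcongr
            · exact Eventually.of_forall fun x =>
                Finset.prod_nonneg fun i _ => by linarith [(hDIcc (x i)).1]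
            · exact Measure.restrict_le_self
        _ = p⁻¹ * (1 + ε) ^ n := by
            rw [hν, integral_fintype_prod_eq_pow (fun y => D y + ε),
              integral_add hDi (integrable_const _), hD1]
            simp
    have hlog := log_le_log (exp_pos _) hjensen
    rw [log_exp, log_mul (by positivity) (by positivity), log_inv, log_pow] at hlog
    have hlε : log (1 + ε) ≤ ε := by linarith [log_le_sub_one_of_pos (by linarith : 0 < 1 + ε)]
    refine hle.trans ?_
    rw [hfint, integral_div, div_add' _ _ _ hn'.ne']
    gcongr
    nlinarith

lemma measurable_atanh : Measurable atanh := by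
  unfold atanh
  fun_prop

lemma log_one_sub_sq {x : ℝ} (hx : x ∈ Set.Ioo (-1 : ℝ) 1) :
    log (1 - x ^ 2) = log (1 + x) + log (1 - x) := by
  rw [← log_mul (by linarith [hx.1]) (by linarith [hx.2])]
  ring_nf

lemma atanh_eq {x : ℝ} (hx : x ∈ Set.Ioo (-1 : ℝ) 1) :
    atanh x = (log (1 + x) - log (1 - x)) / 2 := by
  rw [atanh, log_div (by linarith [hx.1]) (by linarith [hx.2])]

lemma ent_eq {x : ℝ} (hx : x ∈ Set.Ioo (-1 : ℝ) 1) :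
    ent x = log 2 + -log (1 - x ^ 2) / 2 - x * atanh x := by
  rw [log_one_sub_sq hx, atanh_eq hx, ent, log_div (by linarith [hx.1]) (by norm_num),
    log_div (by linarith [hx.2]) (by norm_num)]
  ring

lemma neg_log_one_sub_sq_le {x : ℝ} (hx : x ∈ Set.Ioo (-1 : ℝ) 1) :
    -log (1 - x ^ 2) ≤ 2 * |atanh x| := by
  rw [log_one_sub_sq hx, atanh_eq hx]
  rcases le_total 0 x with h | h
  · have : 0 ≤ log (1 + x) := log_nonneg (by linarith)
    linarith [le_abs_self ((log (1 + x) - log (1 - x)) / 2)]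
  · have : 0 ≤ log (1 - x) := log_nonneg (by linarith)
    linarith [neg_abs_le ((log (1 + x) - log (1 - x)) / 2)]

lemma neg_log_one_sub_sq_nonneg {x : ℝ} (hx : x ∈ Set.Ioo (-1 : ℝ) 1) :
    0 ≤ -log (1 - x ^ 2) := by
  have := log_nonpos (x := 1 - x ^ 2) (by nlinarith [hx.1, hx.2]) (by nlinarith)
  linarith

/-- The functions whose empirical averages determine the functionals of the problem. -/
def stat : Fin 5 → ℝ → ℝ :=
  ![fun x => x, fun x => x ^ 2, fun x => -log (1 - x ^ 2), atanh, fun x => x * atanh x]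

lemma stat_zero (x : ℝ) : stat 0 x = x := rfl
lemma stat_one (x : ℝ) : stat 1 x = x ^ 2 := rfl
lemma stat_two (x : ℝ) : stat 2 x = -log (1 - x ^ 2) := rfl
lemma stat_three (x : ℝ) : stat 3 x = atanh x := rfl
lemma stat_four (x : ℝ) : stat 4 x = x * atanh x := rfl

lemma measurable_stat (k : Fin 5) : Measurable (stat k) := by
  have := measurable_atanh
  fin_cases k <;> simp only [stat] <;> dsimp <;> fun_prop

lemma abs_stat_le {x : ℝ} (hx : x ∈ Set.Ioo (-1 : ℝ) 1) (k : Fin 5) :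
    |stat k x| ≤ 1 + 2 * |atanh x| := by
  have h1 : |x| ≤ 1 := (abs_lt.2 hx).le
  have h0 := abs_nonneg (atanh x)
  have hl := neg_log_one_sub_sq_le hx
  fin_cases k
  · change |x| ≤ _
    linarith
  · change |x ^ 2| ≤ _
    rw [abs_pow]
    nlinarith [abs_nonneg x]
  · change |-log (1 - x ^ 2)| ≤ _
    rw [abs_of_nonneg (neg_log_one_sub_sq_nonneg hx)]
    linarith
  · change |atanh x| ≤ _
    linarith
  · change |x * atanh x| ≤ _
    rw [abs_mul]
    nlinarith

lemma abs_stat_le_weight {x : ℝ} (hx : x ∈ Set.Ioo (-1 : ℝ) 1) (k : Fin 5) {ε : ℝ} (hε : 0 < ε) :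
    |stat k x| ≤ ε * atanh x ^ 2 + (1 + 1 / ε) := by
  refine (abs_stat_le hx k).trans ?_
  have : 2 * |atanh x| ≤ ε * |atanh x| ^ 2 + 1 / ε := by
    have h := sq_nonneg (√ε * |atanh x| - 1 / √ε)
    have e1 : √ε * (1 / √ε) = 1 := by
      have : √ε ≠ 0 := by positivity
      field_simp
    have e2 : (1 / √ε) ^ 2 = 1 / ε := by rw [div_pow, sq_sqrt hε.le, one_pow]
    have e3 := sq_sqrt hε.le
    have e4 : (√ε * |atanh x| - 1 / √ε) ^ 2 = ε * |atanh x| ^ 2 - 2 * |atanh x| + 1 / ε := by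
      linear_combination |atanh x| ^ 2 * e3 - 2 * |atanh x| * e1 + e2
    linarith
  rw [sq_abs] at this
  linarith

/-- `J` as a function of the averages of `stat` and of `atanh ^ 2`. -/
def JStat (β lam : ℝ) (s : Fin 5 → ℝ) (t y : ℝ) : ℝ :=
  β ^ 2 * (1 - s 1) ^ 2 / 2 - log (2 * π * β ^ 2 * s 1) / 2
    + (s 2 - (t + (β ^ 2 * (1 - s 1) - y) ^ 2 * s 1 + (β * lam * s 0) ^ 2
        + 2 * (β ^ 2 * (1 - s 1) - y) * s 4 - 2 * (β * lam * s 0) * s 3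
        - 2 * (β * lam * s 0) * (β ^ 2 * (1 - s 1) - y) * s 0) / (2 * β ^ 2 * s 1))

/-- The tuple of order parameters as a function of the averages of `stat`. -/
def paramStat (β : ℝ) (s : Fin 5 → ℝ) : ℝ × ℝ × ℝ × ℝ :=
  (s 1, s 0, s 4, -(log 2 + s 2 / 2 - s 4 / 2) - β ^ 2 / 4 * (1 - s 1 ^ 2))

lemma continuous_paramStat (β : ℝ) : Continuous (paramStat β) := by
  unfold paramStat
  fun_prop

lemma measurable_JStat (β lam : ℝ) :
    Measurable (fun p : (Fin 5 → ℝ) × ℝ × ℝ => JStat β lam p.1 p.2.1 p.2.2) := by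
  unfold JStat
  fun_prop

lemma continuousAt_JStat {β : ℝ} (hβ : 0 < β) (lam : ℝ) {p : (Fin 5 → ℝ) × ℝ × ℝ}
    (hp : 0 < p.1 1) :
    ContinuousAt (fun p : (Fin 5 → ℝ) × ℝ × ℝ => JStat β lam p.1 p.2.1 p.2.2) p := by
  unfold JStat
  have h1 : 2 * β ^ 2 * p.1 1 ≠ 0 := by positivity
  have h2 : 2 * π * β ^ 2 * p.1 1 ≠ 0 := by positivity
  refine ContinuousAt.add (ContinuousAt.sub (by fun_prop) (ContinuousAt.div_const ?_ _))
    (ContinuousAt.sub (by fun_prop) (ContinuousAt.div (by fun_prop) (by fun_prop) h1))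
  exact ContinuousAt.log (by fun_prop) h2

lemma JStat_anti {β : ℝ} (hβ : 0 < β) (lam : ℝ) {s : Fin 5 → ℝ} (hs : 0 < s 1) {t t' : ℝ}
    (h : t' ≤ t) (y : ℝ) : JStat β lam s t y ≤ JStat β lam s t' y := by
  unfold JStat
  gcongr

lemma log_gdens_eq {x : ℝ} (hx : x ∈ Set.Ioo (-1 : ℝ) 1) (β lam φ q y : ℝ) :
    log (gdens β lam x φ q y) = -log (1 - x ^ 2)
      - (atanh x - β * lam * φ + β ^ 2 * (1 - q) * x - y * x) ^ 2 / (2 * β ^ 2 * q) := by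
  have : 0 < 1 - x ^ 2 := by nlinarith [hx.1, hx.2]
  rw [gdens, log_mul (by positivity) (by positivity), log_exp, log_inv]
  ring

lemma log_gdens_eq_stat {x : ℝ} (hx : x ∈ Set.Ioo (-1 : ℝ) 1) (β lam φ q y : ℝ) :
    log (gdens β lam x φ q y) = stat 2 x + (2 * β ^ 2 * q)⁻¹ *
      (-(atanh x ^ 2) - (β ^ 2 * (1 - q) - y) ^ 2 * stat 1 x - (β * lam * φ) ^ 2
        - 2 * (β ^ 2 * (1 - q) - y) * stat 4 x + 2 * (β * lam * φ) * stat 3 x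
        + 2 * (β * lam * φ) * (β ^ 2 * (1 - q) - y) * stat 0 x) := by
  rw [log_gdens_eq hx, stat_zero, stat_one, stat_two, stat_three, stat_four]
  ring

/-- The vector of averages of `stat` over the coordinates. -/
def avgStat {n : ℕ} (m : Fin n → ℝ) : Fin 5 → ℝ := fun k => (∑ i, stat k (m i)) / n

/-- The average of `atanh ^ 2` over the coordinates. -/
def avgSq {n : ℕ} (m : Fin n → ℝ) : ℝ := (∑ i, atanh (m i) ^ 2) / n

section

variable {n : ℕ} {m : Fin n → ℝ}

lemma Jf_eq_JStat (hn : 0 < n) (hm : ∀ i, m i ∈ Set.Ioo (-1 : ℝ) 1) (β lam y : ℝ) :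
    Jf β lam m y = JStat β lam (avgStat m) (avgSq m) y := by
  have hn' : (n : ℝ) ≠ 0 := by exact_mod_cast hn.ne'
  have hQ : Qf m = avgStat m 1 := rfl
  have hM : Mf m = avgStat m 0 := rfl
  have key : ∀ q φ : ℝ, (∑ i, log (gdens β lam (m i) φ q y)) / n
      = avgStat m 2 + (2 * β ^ 2 * q)⁻¹ *
      (-(avgSq m) - (β ^ 2 * (1 - q) - y) ^ 2 * avgStat m 1 - (β * lam * φ) ^ 2
        - 2 * (β ^ 2 * (1 - q) - y) * avgStat m 4 + 2 * (β * lam * φ) * avgStat m 3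
        + 2 * (β * lam * φ) * (β ^ 2 * (1 - q) - y) * avgStat m 0) := by
    intro q φ
    simp_rw [log_gdens_eq_stat (hm _)]
    simp only [Finset.sum_add_distrib, Finset.sum_sub_distrib, Finset.sum_neg_distrib,
      ← Finset.mul_sum, Finset.sum_const, Finset.card_univ, Fintype.card_fin, nsmul_eq_mul,
      avgStat, avgSq]
    field_simp
  rw [Jf, key, JStat, hQ, hM]
  ring

lemma params_eq_paramStat (hn : 0 < n) (hm : ∀ i, m i ∈ Set.Ioo (-1 : ℝ) 1) (β : ℝ) :
    (Qf m, Mf m, Af m, Ef β m) = paramStat β (avgStat m) := by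
  have hn' : (n : ℝ) ≠ 0 := by exact_mod_cast hn.ne'
  have hQ : Qf m = avgStat m 1 := rfl
  have hM : Mf m = avgStat m 0 := rfl
  have hA : Af m = avgStat m 4 := rfl
  have hE : Ef β m = -(log 2 + avgStat m 2 / 2 - avgStat m 4 / 2)
      - β ^ 2 / 4 * (1 - avgStat m 1 ^ 2) := by
    have : ∀ i, ent (m i) + m i * atanh (m i) / 2
        = log 2 + stat 2 (m i) / 2 - stat 4 (m i) / 2 := fun i => by
      rw [ent_eq (hm i), stat_two, stat_four]; ring
    rw [Ef, hQ]
    simp_rw [this]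
    simp only [Finset.sum_add_distrib, Finset.sum_sub_distrib, ← Finset.sum_div, Finset.sum_const,
      Finset.card_univ, Fintype.card_fin, nsmul_eq_mul, avgStat]
    field_simp
  rw [hQ, hM, hA, hE, paramStat]

lemma avgSq_nonneg : 0 ≤ avgSq m :=
  div_nonneg (Finset.sum_nonneg fun _ _ => sq_nonneg _) n.cast_nonneg

lemma abs_avgStat_le (hn : 0 < n) (hm : ∀ i, m i ∈ Set.Ioo (-1 : ℝ) 1) (k : Fin 5) :
    |avgStat m k| ≤ avgSq m + 2 := by
  have hn' : (0 : ℝ) < n := by exact_mod_cast hn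
  rw [avgStat, avgSq, abs_div, abs_of_pos hn', div_add' _ _ _ hn'.ne']
  gcongr
  refine (Finset.abs_sum_le_sum_abs _ _).trans ?_
  refine (Finset.sum_le_sum fun i _ => abs_stat_le_weight (hm i) k one_pos).trans ?_
  simp [Finset.sum_add_distrib]
  linarith

/-- A Gaussian bound for the exponent. -/
lemma Jf_sub_le {β lam η : ℝ} (hβ : 0 < β) (hlam : 0 ≤ lam) (hη : 0 < η) (hn : 0 < n)
    (hm : ∀ i, m i ∈ Set.Ioo (-1 : ℝ) 1) (hq : Qf m ∈ Set.Icc η 1) (y : ℝ) :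
    Jf β lam m y - y ^ 2 / (2 * β ^ 2)
      ≤ (β ^ 2 / 2 - log (2 * π * β ^ 2 * η) / 2 + (β * lam + β ^ 2) ^ 2 / (4 * β ^ 2)
          + 24 * β ^ 2) - (avgSq m + y ^ 2) / (24 * β ^ 2) := by
  have hn' : (0 : ℝ) < n := by exact_mod_cast hn
  obtain ⟨hq1, hq2⟩ := hq
  have hq0 : 0 < Qf m := hη.trans_le hq1
  set q := Qf m
  have hM : |Mf m| ≤ 1 := by
    rw [Mf, abs_div, abs_of_pos hn', div_le_one hn']
    refine (Finset.abs_sum_le_sum_abs _ _).trans ?_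
    refine (Finset.sum_le_sum fun i _ => (abs_lt.2 (hm i)).le).trans ?_
    simp
  set φ := Mf m
  have hpt : ∀ i, log (gdens β lam (m i) φ q y) ≤ y ^ 2 / (2 * β ^ 2)
      + ((β * lam + β ^ 2) ^ 2 / (4 * β ^ 2) + 24 * β ^ 2)
        - (atanh (m i) ^ 2 + y ^ 2) / (24 * β ^ 2) := by
    intro i
    rw [log_gdens_eq (hm i)]
    have hl := neg_log_one_sub_sq_le (hm i)
    have hx : |m i| ≤ 1 := (abs_lt.2 (hm i)).le
    set u := atanh (m i)
    set x := m i
    set d := β * lam * φ - β ^ 2 * (1 - q) * x with hd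
    have hdB : |d| ≤ β * lam + β ^ 2 := by
      refine (abs_sub _ _).trans ?_
      have a1 : |β * lam * φ| ≤ β * lam := by
        rw [abs_mul, abs_of_nonneg (by positivity)]
        exact mul_le_of_le_one_right (by positivity) hM
      have a2 : |β ^ 2 * (1 - q) * x| ≤ β ^ 2 := by
        rw [abs_mul, abs_of_nonneg (mul_nonneg (by positivity) (by linarith)), mul_assoc]
        refine mul_le_of_le_one_right (by positivity) ?_
        nlinarith [abs_nonneg x]
      linarith
    have hd2 : d ^ 2 ≤ (β * lam + β ^ 2) ^ 2 := sq_le_sq' (abs_le.1 hdB).1 (abs_le.1 hdB).2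
    have e : u - β * lam * φ + β ^ 2 * (1 - q) * x - y * x = u - d - y * x := by rw [hd]; ring
    rw [e]
    have h1 : (u - d - y * x) ^ 2 / (2 * β ^ 2) ≤ (u - d - y * x) ^ 2 / (2 * β ^ 2 * q) := by
      refine div_le_div_of_nonneg_left (sq_nonneg _) (by positivity) ?_
      nlinarith [sq_nonneg β]
    have hyx : (y * x) ^ 2 ≤ y ^ 2 := by
      rw [mul_pow, ← sq_abs x]
      have : |x| ^ 2 ≤ 1 := pow_le_one₀ (abs_nonneg x) hx
      nlinarith [sq_nonneg y]
    have h2 : u ^ 2 / 6 - (β * lam + β ^ 2) ^ 2 / 2 + y ^ 2 / 2 ≤ (u - d - y * x) ^ 2 + y ^ 2 := by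
      nlinarith [sq_nonneg (u - d - y * x - d), sq_nonneg (u - d - y * x - y * x),
        sq_nonneg (d - y * x)]
    have h3 : 2 * |u| ≤ u ^ 2 / (24 * β ^ 2) + 24 * β ^ 2 := by
      have := sq_nonneg (|u| - 24 * β ^ 2)
      rw [← sq_abs u, div_add' _ _ _ (by positivity), le_div_iff₀ (by positivity)]
      nlinarith
    have h4 := div_le_div_of_nonneg_right h2 (by positivity : 0 ≤ 2 * β ^ 2)
    have e1 : (u ^ 2 / 6 - (β * lam + β ^ 2) ^ 2 / 2 + y ^ 2 / 2) / (2 * β ^ 2)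
        = 2 * (u ^ 2 / (24 * β ^ 2)) - (β * lam + β ^ 2) ^ 2 / (4 * β ^ 2)
          + 6 * (y ^ 2 / (24 * β ^ 2)) := by
      field_simp; ring
    rw [e1, add_div] at h4
    rw [add_div]
    have h5 : 0 ≤ y ^ 2 / (24 * β ^ 2) := by positivity
    linarith
  have hsum : (∑ i, log (gdens β lam (m i) φ q y)) / n ≤ y ^ 2 / (2 * β ^ 2)
      + ((β * lam + β ^ 2) ^ 2 / (4 * β ^ 2) + 24 * β ^ 2)
        - (avgSq m + y ^ 2) / (24 * β ^ 2) := by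
    rw [div_le_iff₀ hn']
    refine (Finset.sum_le_sum fun i _ => hpt i).trans (le_of_eq ?_)
    simp only [Finset.sum_add_distrib, Finset.sum_sub_distrib, ← Finset.sum_div, Finset.sum_const,
      Finset.card_univ, Fintype.card_fin, nsmul_eq_mul, avgSq]
    field_simp
  have hl : log (2 * π * β ^ 2 * η) ≤ log (2 * π * β ^ 2 * q) := by gcongr
  have hq' : β ^ 2 * (1 - q) ^ 2 / 2 ≤ β ^ 2 / 2 := by
    have : (1 - q) ^ 2 ≤ 1 := pow_le_one₀ (by linarith) (by linarith)
    nlinarith [sq_nonneg β]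
  rw [Jf]
  linarith

end

/-- The uniform probability measure on `(-1, 1)`, as a measure on `ℝ`. -/
def unifReal : Measure ℝ := (2⁻¹ : ℝ≥0∞) • volume.restrict (Set.Ioo (-1 : ℝ) 1)

instance : IsProbabilityMeasure unifReal := by
  constructor
  rw [unifReal, Measure.smul_apply, Measure.restrict_apply_univ, Real.volume_Ioo]
  norm_num
  exact ENNReal.inv_mul_cancel (by norm_num) (by norm_num)

lemma map_val_unif11 : unif11.map Subtype.val = unifReal := by
  rw [unif11, Measure.map_smul, map_comap_subtype_coe measurableSet_Ioo, unifReal]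

instance : IsProbabilityMeasure unif11 := by
  constructor
  have h : unifReal Set.univ = 1 := measure_univ
  rwa [← map_val_unif11, Measure.map_apply measurable_subtype_coe MeasurableSet.univ,
    Set.preimage_univ] at h

lemma measurableEmbedding_val : MeasurableEmbedding (Subtype.val : Int11 → ℝ) :=
  MeasurableEmbedding.subtype_coe measurableSet_Ioo

lemma ae_mem_unifReal : ∀ᵐ x ∂unifReal, x ∈ Set.Ioo (-1 : ℝ) 1 := by
  rw [unifReal]
  exact Measure.ae_smul_measure (ae_restrict_mem measurableSet_Ioo) _

lemma coe_integral_eq_lintegral_sub {X : Type*} [MeasurableSpace X] {μ : Measure X} {f : X → ℝ}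
    (hf : Integrable f μ) : ((∫ x, f x ∂μ : ℝ) : EReal)
      = ((∫⁻ x, ENNReal.ofReal (f x) ∂μ : ℝ≥0∞) : EReal)
        - ((∫⁻ x, ENNReal.ofReal (-f x) ∂μ : ℝ≥0∞) : EReal) := by
  rw [integral_eq_lintegral_pos_part_sub_lintegral_neg_part hf, EReal.coe_sub]
  have h1 : ∫⁻ x, ENNReal.ofReal (f x) ∂μ ≠ ⊤ := hf.lintegral_lt_top.ne
  have h2 : ∫⁻ x, ENNReal.ofReal (-f x) ∂μ ≠ ⊤ := hf.neg.lintegral_lt_top.ne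
  rw [EReal.coe_ennreal_toReal h1, EReal.coe_ennreal_toReal h2]

section

variable {D : ℝ → ℝ}

/-- The measure on `(-1, 1)` with density `D` with respect to the uniform distribution. -/
def densMeasure (D : ℝ → ℝ) : Measure Int11 :=
  unif11.withDensity fun x => ENNReal.ofReal (D x)

lemma integrable_densMeasure_iff (hD : Measurable D) (hD0 : ∀ x, 0 ≤ D x) {f : ℝ → ℝ} :
    Integrable (fun x : Int11 => f x) (densMeasure D)
      ↔ Integrable (fun x => f x * D x) unifReal := by
  rw [densMeasure, integrable_withDensity_iff (by fun_prop) (by simp), ← map_val_unif11,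
    measurableEmbedding_val.integrable_map_iff]
  simp only [ENNReal.toReal_ofReal (hD0 _)]
  rfl

lemma integral_densMeasure (hD : Measurable D) (hD0 : ∀ x, 0 ≤ D x) (f : ℝ → ℝ) :
    ∫ x : Int11, f x ∂(densMeasure D) = ∫ x, f x * D x ∂unifReal := by
  rw [densMeasure, integral_withDensity_eq_integral_toReal_smul (by fun_prop) (by simp),
    ← map_val_unif11, measurableEmbedding_val.integral_map]
  simp only [ENNReal.toReal_ofReal (hD0 _), smul_eq_mul, mul_comm]

lemma isProbabilityMeasure_densMeasure (hD0 : ∀ x, 0 ≤ D x)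
    (hDi : Integrable D unifReal) (h1 : ∫ x, D x ∂unifReal = 1) :
    IsProbabilityMeasure (densMeasure D) := by
  constructor
  rw [densMeasure, withDensity_apply _ MeasurableSet.univ, setLIntegral_univ,
    ← measurableEmbedding_val.lintegral_map (fun x => ENNReal.ofReal (D x)), map_val_unif11,
    ← ofReal_integral_eq_lintegral_ofReal hDi (ae_of_all _ hD0), h1, ENNReal.ofReal_one]

lemma relEnt_densMeasure (hD : Measurable D) (hD0 : ∀ x, 0 ≤ D x)
    (hDi : Integrable D unifReal) (h1 : ∫ x, D x ∂unifReal = 1)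
    (hkl : Integrable (fun x => klFun (D x)) unifReal) :
    relEnt (densMeasure D) unif11 = ((∫ x, klFun (D x) ∂unifReal : ℝ) : EReal) := by
  have hac : densMeasure D ≪ unif11 := withDensity_absolutelyContinuous _ _
  have hrn : (densMeasure D).rnDeriv unif11 =ᵐ[densMeasure D] fun x => ENNReal.ofReal (D x) :=
    hac.ae_le (Measure.rnDeriv_withDensity _ (by fun_prop))
  have hmul : (fun x => log (D x) * D x) = fun x => klFun (D x) - 1 + D x := by
    ext x; simp only [klFun]; ring
  have hi : Integrable (fun x => log (D x) * D x) unifReal := by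
    rw [hmul]; exact (hkl.sub (integrable_const 1)).add hDi
  have hi' : Integrable (fun x : Int11 => log (D x)) (densMeasure D) :=
    (integrable_densMeasure_iff (f := fun x => log (D x)) hD hD0).2 hi
  have hval : ∫ x, log (D x) * D x ∂unifReal = ∫ x, klFun (D x) ∂unifReal := by
    have hs : Integrable (fun x => klFun (D x) - 1) unifReal := hkl.sub (integrable_const 1)
    rw [hmul, integral_add hs hDi, integral_sub hkl (integrable_const 1), h1]
    simp
  rw [relEnt, if_pos hac, ← hval, ← integral_densMeasure hD hD0 (fun x => log (D x)),
    coe_integral_eq_lintegral_sub hi']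
  congr 1 <;> congr 1
  · refine lintegral_congr_ae ?_
    filter_upwards [hrn] with x hx
    rw [hx, ENNReal.toReal_ofReal (hD0 _)]
  · refine lintegral_congr_ae ?_
    filter_upwards [hrn] with x hx
    rw [hx, ENNReal.toReal_ofReal (hD0 _)]

end

lemma ae_abs_stat_le (k : Fin 5) {ε : ℝ} (hε : 0 < ε) :
    ∃ C, ∀ᵐ x ∂unifReal, |stat k x| ≤ ε * atanh x ^ 2 + C :=
  ⟨1 + 1 / ε, ae_mem_unifReal.mono fun _ hx => abs_stat_le_weight hx k hε⟩

section

variable {D : ℝ → ℝ} {s : Fin 5 → ℝ} {t : ℝ}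

lemma IsMomentDensity.integrable_stat
    (h : IsMomentDensity unifReal stat (fun x => atanh x ^ 2) s t 0 D) (k : Fin 5) :
    Integrable (fun x => stat k x * D x) unifReal := by
  obtain ⟨C, hC⟩ := ae_abs_stat_le k one_pos
  exact integrable_mul_of_le_weight (measurable_stat k) h.measurable hC h.nonneg h.integrable
    h.integrable_weight

lemma IsMomentDensity.integral_stat
    (h : IsMomentDensity unifReal stat (fun x => atanh x ^ 2) s t 0 D) (k : Fin 5) :
    ∫ x, stat k x * D x ∂unifReal = s k := by
  have := abs_nonpos_iff.1 (h.abs_integral_sub_le k)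
  linarith

theorem IsMomentDensity.le_iSup_functional {β : ℝ} (hβ : 0 < β) (lam : ℝ) {U : Set (ℝ × ℝ × ℝ × ℝ)}
    (h : IsMomentDensity unifReal stat (fun x => atanh x ^ 2) s t 0 D)
    (hkl : Integrable (fun x => klFun (D x)) unifReal) (hs : 0 < s 1) (hU : paramStat β s ∈ U)
    (y : ℝ) :
    ((JStat β lam s t y - ∫ x, klFun (D x) ∂unifReal - y ^ 2 / (2 * β ^ 2) + log 2 : ℝ) : EReal)
      ≤ ⨆ (ρ : ProbabilityMeasure Int11)
          (_ : (Qm ρ, Mm ρ, Am ρ, Em β ρ) ∈ U) (y : ℝ),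
          (JE β lam ρ y - relEnt (ρ : Measure Int11) unif11
            - ((y ^ 2 / (2 * β ^ 2) : ℝ) : EReal) + ((Real.log 2 : ℝ) : EReal)) := by
  have hDm := h.measurable
  have hD0 := h.nonneg
  have hP := isProbabilityMeasure_densMeasure hD0 h.integrable h.integral_eq_one
  let ρ : ProbabilityMeasure Int11 := ⟨densMeasure D, hP⟩
  have hi : ∀ k, Integrable (fun x : Int11 => stat k x) (densMeasure D) := fun k =>
    (integrable_densMeasure_iff hDm hD0).2 (h.integrable_stat k)
  have hs' : ∀ k, ∫ x : Int11, stat k x ∂(densMeasure D) = s k := fun k =>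
    (integral_densMeasure hDm hD0 _).trans (h.integral_stat k)
  have hw : Integrable (fun x : Int11 => atanh x ^ 2) (densMeasure D) :=
    (integrable_densMeasure_iff (f := fun x => atanh x ^ 2) hDm hD0).2 h.integrable_weight
  have hw' : ∫ x : Int11, atanh x ^ 2 ∂(densMeasure D) ≤ t := by
    rw [integral_densMeasure hDm hD0 (fun x => atanh x ^ 2)]
    simpa using h.integral_weight_le
  set t' := ∫ x : Int11, atanh x ^ 2 ∂(densMeasure D) with ht'
  have hQ : Qm ρ = s 1 := hs' 1
  have hM : Mm ρ = s 0 := hs' 0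
  have hA : Am ρ = s 4 := hs' 4
  have hE : Em β ρ = -(log 2 + s 2 / 2 - s 4 / 2) - β ^ 2 / 4 * (1 - s 1 ^ 2) := by
    have e : ∀ x : Int11, ent x + x * atanh x / 2 = log 2 + stat 2 x / 2 - stat 4 x / 2 :=
      fun x => by rw [ent_eq x.2, stat_two, stat_four]; ring
    have i1 : Integrable (fun x : Int11 => log 2 + stat 2 x / 2) (densMeasure D) :=
      (integrable_const _).add ((hi 2).div_const 2)
    rw [Em, hQ]
    simp_rw [e]
    change -∫ x : Int11, (log 2 + stat 2 x / 2 - stat 4 x / 2) ∂(densMeasure D) - _ = _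
    rw [integral_sub i1 ((hi 4).div_const 2),
      integral_add (integrable_const _) ((hi 2).div_const 2),
      integral_div, integral_div, hs', hs']
    simp
  have hmem : (Qm ρ, Mm ρ, Am ρ, Em β ρ) ∈ U := by
    rw [hQ, hM, hA, hE]; exact hU
  have hJ : JE β lam ρ y = ((JStat β lam s t' y : ℝ) : EReal) := by
    have hlog : ∀ x : Int11, log (gdens β lam x (s 0) (s 1) y)
        = stat 2 x + (2 * β ^ 2 * s 1)⁻¹ *
      (-(atanh x ^ 2) - (β ^ 2 * (1 - s 1) - y) ^ 2 * stat 1 x - (β * lam * s 0) ^ 2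
        - 2 * (β ^ 2 * (1 - s 1) - y) * stat 4 x + 2 * (β * lam * s 0) * stat 3 x
        + 2 * (β * lam * s 0) * (β ^ 2 * (1 - s 1) - y) * stat 0 x) :=
      fun x => log_gdens_eq_stat x.2 _ _ _ _ _
    have j1 : Integrable (fun x : Int11 => -(atanh x ^ 2)) (densMeasure D) := hw.neg
    have j2 := j1.sub ((hi 1).const_mul ((β ^ 2 * (1 - s 1) - y) ^ 2))
    have j3 := j2.sub (integrable_const (μ := densMeasure D) ((β * lam * s 0) ^ 2))
    have j4 := j3.sub ((hi 4).const_mul (2 * (β ^ 2 * (1 - s 1) - y)))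
    have j5 := j4.add ((hi 3).const_mul (2 * (β * lam * s 0)))
    have j6 := j5.add ((hi 0).const_mul (2 * (β * lam * s 0) * (β ^ 2 * (1 - s 1) - y)))
    have j7 := (hi 2).add (j6.const_mul (2 * β ^ 2 * s 1)⁻¹)
    have hli : Integrable (fun x : Int11 => log (gdens β lam x (s 0) (s 1) y))
        (densMeasure D) := by
      simp_rw [hlog]; exact j7
    have hint : ∫ x : Int11, log (gdens β lam x (s 0) (s 1) y) ∂(densMeasure D)
        = s 2 + (2 * β ^ 2 * s 1)⁻¹ *
      (-t' - (β ^ 2 * (1 - s 1) - y) ^ 2 * s 1 - (β * lam * s 0) ^ 2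
        - 2 * (β ^ 2 * (1 - s 1) - y) * s 4 + 2 * (β * lam * s 0) * s 3
        + 2 * (β * lam * s 0) * (β ^ 2 * (1 - s 1) - y) * s 0) := by
      simp_rw [hlog]
      refine (integral_add (hi 2) (j6.const_mul _)).trans ?_
      rw [integral_const_mul, hs', integral_add' j5 ((hi 0).const_mul _),
        integral_add' j4 ((hi 3).const_mul _), integral_sub' j3 ((hi 4).const_mul _),
        integral_sub' j2 (integrable_const _), integral_sub' j1 ((hi 1).const_mul _),
        integral_neg, integral_const_mul, integral_const_mul, integral_const_mul,
        integral_const_mul, hs', hs', hs', hs']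
      simp [ht']
    have hJE : JE β lam ρ y = ((β ^ 2 * (1 - s 1) ^ 2 / 2 - log (2 * π * β ^ 2 * s 1) / 2
        + ∫ x : Int11, log (gdens β lam x (s 0) (s 1) y) ∂(densMeasure D) : ℝ) : EReal) := by
      rw [EReal.coe_add, coe_integral_eq_lintegral_sub hli, JE, hQ, hM, sub_eq_add_neg,
        sub_eq_add_neg, add_assoc]
      rfl
    rw [hJE, hint, JStat]
    congr 1
    ring
  refine le_trans ?_ (le_iSup₂_of_le ρ hmem (le_iSup _ y))
  rw [hJ, show ((ρ : Measure Int11)) = densMeasure D from rfl,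
    relEnt_densMeasure hDm hD0 h.integrable h.integral_eq_one hkl, ← EReal.coe_sub,
    ← EReal.coe_sub, ← EReal.coe_add, EReal.coe_le_coe_iff]
  linarith [JStat_anti hβ lam hs hw' y]

end

lemma volume_restrict_pi_Ioo (n : ℕ) :
    (volume : Measure (Fin n → ℝ)).restrict
        (Set.pi Set.univ fun _ : Fin n => Set.Ioo (-1 : ℝ) 1)
      = (2 : ℝ≥0∞) ^ n • Measure.pi fun _ : Fin n => unifReal := by
  have h : Measure.pi (fun _ : Fin n => unifReal)
      = (2⁻¹ : ℝ≥0∞) ^ n • Measure.pi fun _ : Fin n => volume.restrict (Set.Ioo (-1 : ℝ) 1) := by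
    refine Measure.pi_eq fun A _ => ?_
    simp [unifReal, Measure.pi_pi, Finset.prod_mul_distrib]
  rw [h, smul_smul, ← mul_pow, ENNReal.mul_inv_cancel (by norm_num) (by norm_num), one_pow,
    one_smul, volume_pi, Measure.restrict_pi_pi]

lemma measurable_avgStat (n : ℕ) : Measurable (avgStat : (Fin n → ℝ) → Fin 5 → ℝ) := by
  refine measurable_pi_lambda _ fun k => Measurable.div_const ?_ _
  exact Finset.measurable_sum _ fun i _ => (measurable_stat k).comp (measurable_pi_apply i)

lemma measurable_avgSq (n : ℕ) : Measurable (avgSq : (Fin n → ℝ) → ℝ) := by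
  refine Measurable.div_const ?_ _
  exact Finset.measurable_sum _ fun i _ =>
    (measurable_atanh.comp (measurable_pi_apply i)).pow_const 2

/-- The exponent, as a function of the averages of `stat` and `atanh ^ 2` and of `y`. -/
def rateFun (β lam : ℝ) (p : (Fin 5 → ℝ) × ℝ × ℝ) : ℝ :=
  JStat β lam p.1 p.2.1 p.2.2 - p.2.2 ^ 2 / (2 * β ^ 2)

lemma measurable_rateFun (β lam : ℝ) : Measurable (rateFun β lam) :=
  (measurable_JStat β lam).sub (by fun_prop)

/-- The averages of a configuration, together with the auxiliary variable. -/
def avgMap {n : ℕ} (z : (Fin n → ℝ) × ℝ) : (Fin 5 → ℝ) × ℝ × ℝ := (avgStat z.1, avgSq z.1, z.2)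

lemma measurable_avgMap (n : ℕ) : Measurable (avgMap : (Fin n → ℝ) × ℝ → _) :=
  ((measurable_avgStat n).comp measurable_fst).prodMk
    (((measurable_avgSq n).comp measurable_fst).prodMk measurable_snd)

/-- The configurations in the cube whose averages lie in `A`. -/
def configSet (n : ℕ) (A : Set ((Fin 5 → ℝ) × ℝ × ℝ)) : Set ((Fin n → ℝ) × ℝ) :=
  {z | z.1 ∈ Set.pi Set.univ (fun _ : Fin n => Set.Ioo (-1 : ℝ) 1) ∧ avgMap z ∈ A}

lemma measurableSet_configSet (n : ℕ) {A : Set ((Fin 5 → ℝ) × ℝ × ℝ)} (hA : MeasurableSet A) :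
    MeasurableSet (configSet n A) :=
  (measurable_fst (MeasurableSet.univ_pi fun _ => measurableSet_Ioo)).inter
    (measurable_avgMap n hA)

/-- The exponential integral over the configurations whose averages lie in `A`. -/
def expInt (β lam : ℝ) (n : ℕ) (A : Set ((Fin 5 → ℝ) × ℝ × ℝ)) : ℝ≥0∞ :=
  ∫⁻ z in configSet n A, ENNReal.ofReal (exp (n * rateFun β lam (avgMap z)))

/-- `expInt` grows at exponential rate at most `r` on `A`. -/
def ExpBound (β lam r : ℝ) (A : Set ((Fin 5 → ℝ) × ℝ × ℝ)) : Prop :=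
  ∃ C : ℝ≥0, ∀ n : ℕ, 0 < n → expInt β lam n A ≤ C * ENNReal.ofReal (exp (n * r))

section

variable {β lam r : ℝ} {A B : Set ((Fin 5 → ℝ) × ℝ × ℝ)}

lemma ExpBound.mono_of_configSet (hB : ExpBound β lam r B)
    (h : ∀ n, 0 < n → configSet n A ⊆ configSet n B) : ExpBound β lam r A := by
  obtain ⟨C, hC⟩ := hB
  exact ⟨C, fun n hn => (lintegral_mono_set (h n hn)).trans (hC n hn)⟩

lemma ExpBound.mono (hB : ExpBound β lam r B) (h : A ⊆ B) : ExpBound β lam r A :=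
  hB.mono_of_configSet fun _ _ _ hz => ⟨hz.1, h hz.2⟩

lemma ExpBound.union (hA : ExpBound β lam r A) (hB : ExpBound β lam r B) :
    ExpBound β lam r (A ∪ B) := by
  obtain ⟨C, hC⟩ := hA
  obtain ⟨C', hC'⟩ := hB
  refine ⟨C + C', fun n hn => ?_⟩
  have e : configSet n (A ∪ B) = configSet n A ∪ configSet n B := by
    ext z; simp only [configSet, Set.mem_ofPred_eq, Set.mem_union]; tauto
  rw [expInt, e, ENNReal.coe_add, add_mul]
  exact (lintegral_union_le _ _ _).trans (add_le_add (hC n hn) (hC' n hn))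

lemma expBound_empty : ExpBound β lam r ∅ :=
  ⟨0, fun n _ => by simp [expInt, configSet]⟩

end

lemma Tval_le {β lam C₀ b : ℝ} {U : Set (ℝ × ℝ × ℝ × ℝ)} (hU : IsClosed U) {n : ℕ} (hn : 0 < n) :
    Tval n β lam C₀ b U ≤ ENNReal.ofReal (√(n / (2 * π * β ^ 2)))
      * (ENNReal.ofReal (exp (C₀ * (n : ℝ) ^ max 0.9 b))
        * expInt β lam n {p | paramStat β p.1 ∈ U}) := by
  have hA : MeasurableSet {p : (Fin 5 → ℝ) × ℝ × ℝ | paramStat β p.1 ∈ U} :=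
    ((hU.preimage (continuous_paramStat β)).preimage continuous_fst).measurableSet
  have hS := measurableSet_configSet n hA
  have hF : Measurable fun z : (Fin n → ℝ) × ℝ =>
      ENNReal.ofReal (exp (n * rateFun β lam (avgMap z))) := by
    have := (measurable_rateFun β lam).comp (measurable_avgMap n)
    exact ((this.const_mul _).exp).ennreal_ofReal
  rw [Tval]
  gcongr
  rw [expInt, ← lintegral_indicator hS, Measure.volume_eq_prod,
    lintegral_prod _ (hF.indicator hS).aemeasurable, ← lintegral_const_mul' _ _ (by simp)]
  refine (setLIntegral_mono' (MeasurableSet.univ_pi fun _ => measurableSet_Ioo)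
    fun m hm => ?_).trans (setLIntegral_le_lintegral _ _)
  rw [← lintegral_const_mul' _ _ (by simp)]
  refine lintegral_mono fun y => ?_
  have hm' : ∀ i, m i ∈ Set.Ioo (-1 : ℝ) 1 := fun i => hm i trivial
  split_ifs with h
  · rw [params_eq_paramStat hn hm'] at h
    rw [Set.indicator_of_mem (show (m, y) ∈ configSet n _ from ⟨hm, h⟩),
      ← ENNReal.ofReal_mul (exp_pos _).le, ← exp_add, Jf_eq_JStat hn hm']
    refine ENNReal.ofReal_le_ofReal (exp_le_exp.2 (le_of_eq ?_))
    simp only [rateFun, avgMap]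
    ring
  · exact zero_le

/-- The exponential bound near a point, via Sanov's theorem. -/
lemma exists_nhds_expBound {β : ℝ} (hβ : 0 < β) (lam : ℝ) {U : Set (ℝ × ℝ × ℝ × ℝ)}
    {p : (Fin 5 → ℝ) × ℝ × ℝ} (hp : 0 < p.1 1) (hpU : paramStat β p.1 ∈ U) {r ε : ℝ}
    (hr : (⨆ (ρ : ProbabilityMeasure Int11)
          (_ : (Qm ρ, Mm ρ, Am ρ, Em β ρ) ∈ U) (y : ℝ),
          (JE β lam ρ y - relEnt (ρ : Measure Int11) unif11
            - ((y ^ 2 / (2 * β ^ 2) : ℝ) : EReal) + ((Real.log 2 : ℝ) : EReal))) ≤ (r : EReal))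
    (hε : 0 < ε) : ∃ N ∈ 𝓝 p, ExpBound β lam (r + 2 * ε) N := by
  obtain ⟨s, t, y⟩ := p
  set G := rateFun β lam (s, t, y) with hG
  set h₀ := G + log 2 - r - ε with hh₀
  have hS : ∀ k, ∀ ε > 0, ∃ C, ∀ᵐ x ∂unifReal, |stat k x| ≤ ε * atanh x ^ 2 + C :=
    fun k ε hε => ae_abs_stat_le k hε
  have hδ : ∃ δ > 0, ∀ D, IsMomentDensity unifReal stat (fun x => atanh x ^ 2) s t δ D →
      Integrable (fun x => klFun (D x)) unifReal → h₀ < ∫ x, klFun (D x) ∂unifReal := by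
    by_contra! hcon
    obtain ⟨D, hD, hDi, hDh⟩ := exists_isMomentDensity_of_forall_pos measurable_stat hS
      (fun x => sq_nonneg _) (fun δ hδ => hcon δ hδ)
    have := (hD.le_iSup_functional hβ lam hDi hp hpU y).trans hr
    rw [EReal.coe_le_coe_iff] at this
    simp only [rateFun] at hG
    linarith
  obtain ⟨δ, hδ, hD⟩ := hδ
  set N : Set ((Fin 5 → ℝ) × ℝ × ℝ) := {p | (∀ k, |p.1 k - s k| ≤ δ) ∧ p.2.1 ≤ t + δ
    ∧ p.2.2 ∈ Set.Icc (y - 1) (y + 1) ∧ rateFun β lam p ≤ G + ε} with hN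
  have hNm : MeasurableSet N := by
    have m1 := measurable_rateFun β lam
    refine MeasurableSet.inter ?_ (MeasurableSet.inter ?_ (MeasurableSet.inter ?_ ?_))
    · change MeasurableSet {p : (Fin 5 → ℝ) × ℝ × ℝ | ∀ k, |p.1 k - s k| ≤ δ}
      rw [Set.ofPred_forall]
      exact MeasurableSet.iInter fun k => measurableSet_le (by fun_prop) measurable_const
    · exact measurableSet_le measurable_snd.fst measurable_const
    · exact measurableSet_Icc.preimage measurable_snd.snd
    · exact measurableSet_le m1 measurable_const
  refine ⟨N, ?_, 2, fun n hn => ?_⟩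
  · have c1 : ContinuousAt (rateFun β lam) (s, t, y) :=
      (continuousAt_JStat hβ lam (p := (s, t, y)) hp).sub (by fun_prop)
    have e1 := c1.eventually_le_const (show G < G + ε by linarith)
    have e2 : ∀ᶠ p : (Fin 5 → ℝ) × ℝ × ℝ in 𝓝 (s, t, y), ∀ k, |p.1 k - s k| ≤ δ := by
      refine eventually_all.2 fun k => ?_
      have : ContinuousAt (fun p : (Fin 5 → ℝ) × ℝ × ℝ => |p.1 k - s k|) (s, t, y) := by fun_prop
      exact this.eventually_le_const (by simpa using hδ)
    have e3 : ∀ᶠ p : (Fin 5 → ℝ) × ℝ × ℝ in 𝓝 (s, t, y), p.2.1 ≤ t + δ := by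
      have : ContinuousAt (fun p : (Fin 5 → ℝ) × ℝ × ℝ => p.2.1) (s, t, y) := by fun_prop
      exact this.eventually_le_const (by simpa using hδ)
    have e4 : ∀ᶠ p : (Fin 5 → ℝ) × ℝ × ℝ in 𝓝 (s, t, y), p.2.2 ∈ Set.Icc (y - 1) (y + 1) := by
      have : ContinuousAt (fun p : (Fin 5 → ℝ) × ℝ × ℝ => p.2.2) (s, t, y) := by fun_prop
      exact this.eventually (Icc_mem_nhds (by simp) (by simp))
    filter_upwards [e1, e2, e3, e4] with p h1 h2 h3 h4 using ⟨h2, h3, h4, h1⟩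
  · have hn' : (0 : ℝ) < n := by exact_mod_cast hn
    set box : Set (Fin n → ℝ) := Set.pi Set.univ fun _ : Fin n => Set.Ioo (-1 : ℝ) 1 with hbox
    have hboxm : MeasurableSet box := MeasurableSet.univ_pi fun _ => measurableSet_Ioo
    set B : Set (Fin n → ℝ) := {x | (∀ k, |(∑ i, stat k (x i)) / n - s k| ≤ δ) ∧
      (∑ i, atanh (x i) ^ 2) / n ≤ t + δ} with hB
    have hPB : Measure.pi (fun _ : Fin n => unifReal) B ≤ ENNReal.ofReal (exp (-(n * h₀))) := by
      by_cases h0 : Measure.pi (fun _ : Fin n => unifReal) B = 0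
      · rw [h0]; exact zero_le
      obtain ⟨D, hDd, hDi, hDh⟩ := exists_isMomentDensity_of_pi_pos measurable_stat
        (measurable_atanh.pow_const 2)
        (fun k => by simpa using ae_abs_stat_le k one_pos) (fun x => sq_nonneg _) hn hB h0
      have hlt := (hD D hDd hDi).trans_le hDh
      rw [lt_div_iff₀ hn'] at hlt
      rw [← ofReal_measureReal]
      refine ENNReal.ofReal_le_ofReal ?_
      have hpos : 0 < (Measure.pi (fun _ : Fin n => unifReal)).real B :=
        ENNReal.toReal_pos h0 (measure_ne_top _ _)
      rw [← log_le_iff_le_exp hpos]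
      linarith
    have hvol : volume (box ∩ B) = 2 ^ n * Measure.pi (fun _ : Fin n => unifReal) B := by
      rw [Set.inter_comm, ← Measure.restrict_apply' hboxm, volume_restrict_pi_Ioo]
      rfl
    have hsub : configSet n N ⊆ (box ∩ B) ×ˢ Set.Icc (y - 1) (y + 1) :=
      fun z hz => ⟨⟨hz.1, hz.2.1, hz.2.2.1⟩, hz.2.2.2.1⟩
    calc expInt β lam n N
        ≤ ∫⁻ z in configSet n N, ENNReal.ofReal (exp (n * (G + ε))) := by
          refine setLIntegral_mono' (measurableSet_configSet n hNm) fun z hz => ?_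
          have := hz.2.2.2.2
          gcongr
      _ = ENNReal.ofReal (exp (n * (G + ε))) * volume (configSet n N) := by
          rw [setLIntegral_const]
      _ ≤ ENNReal.ofReal (exp (n * (G + ε)))
          * (2 ^ n * ENNReal.ofReal (exp (-(n * h₀))) * 2) := by
          gcongr
          refine (measure_mono hsub).trans ?_
          rw [Measure.volume_eq_prod, Measure.prod_prod, hvol, Real.volume_Icc]
          gcongr
          rw [show y + 1 - (y - 1) = 2 by ring]
          simp
      _ = (2 : ℝ≥0) * ENNReal.ofReal (exp (n * (r + 2 * ε))) := by
          have e2 : (2 : ℝ≥0∞) ^ n = ENNReal.ofReal (exp (n * log 2)) := by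
            rw [mul_comm, exp_mul, exp_log two_pos, rpow_natCast, ENNReal.ofReal_pow two_pos.le]
            simp
          rw [e2, ← ENNReal.ofReal_mul (exp_pos _).le, ← mul_assoc,
            ← ENNReal.ofReal_mul (exp_pos _).le, ← exp_add, ← exp_add, mul_comm]
          congr 4
          rw [hh₀]; ring

lemma expBound_compact {β : ℝ} (hβ : 0 < β) (lam : ℝ) {U : Set (ℝ × ℝ × ℝ × ℝ)} {r r' : ℝ}
    (hr : (⨆ (ρ : ProbabilityMeasure Int11)
          (_ : (Qm ρ, Mm ρ, Am ρ, Em β ρ) ∈ U) (y : ℝ),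
          (JE β lam ρ y - relEnt (ρ : Measure Int11) unif11
            - ((y ^ 2 / (2 * β ^ 2) : ℝ) : EReal) + ((Real.log 2 : ℝ) : EReal))) ≤ (r : EReal))
    (hrr : r < r') {K : Set ((Fin 5 → ℝ) × ℝ × ℝ)} (hK : IsCompact K)
    (hKpos : ∀ p ∈ K, 0 < p.1 1) (hKU : ∀ p ∈ K, paramStat β p.1 ∈ U) :
    ExpBound β lam r' K := by
  refine hK.induction_on expBound_empty (fun A B hAB hB => hB.mono hAB)
    (fun A B hA hB => hA.union hB) fun p hp => ?_
  obtain ⟨N, hN, hb⟩ := exists_nhds_expBound hβ lam (hKpos p hp) (hKU p hp) hr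
    (half_pos (sub_pos.2 hrr))
  refine ⟨N, mem_nhdsWithin_of_mem_nhds hN, ?_⟩
  rwa [show r + 2 * ((r' - r) / 2) = r' by ring] at hb

lemma exists_expBound_tail {β lam η : ℝ} (hβ : 0 < β) (hlam : 0 ≤ lam) (hη : 0 < η)
    {U : Set (ℝ × ℝ × ℝ × ℝ)} (hU : IsClosed U) (hUsub : ∀ p ∈ U, p.1 ∈ Set.Icc η 1) (r : ℝ) :
    ∃ R : ℝ, ExpBound β lam r {p | paramStat β p.1 ∈ U ∧ R < p.2.1 + p.2.2 ^ 2} := by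
  set C := β ^ 2 / 2 - log (2 * π * β ^ 2 * η) / 2 + (β * lam + β ^ 2) ^ 2 / (4 * β ^ 2)
          + 24 * β ^ 2 with hC
  set κ := (24 * β ^ 2)⁻¹ / 2 with hκ
  have hκ0 : 0 < κ := by positivity
  set R := (C + log 2 - r) / κ with hR
  have hI : Integrable fun y : ℝ => exp (-κ * y ^ 2) := integrable_exp_neg_mul_sq hκ0
  have hIt : ∫⁻ y : ℝ, ENNReal.ofReal (exp (-κ * y ^ 2)) ≠ ⊤ := hI.lintegral_lt_top.ne
  refine ⟨R, (∫⁻ y : ℝ, ENNReal.ofReal (exp (-κ * y ^ 2))).toNNReal, fun n hn => ?_⟩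
  rw [ENNReal.coe_toNNReal hIt]
  set A : Set ((Fin 5 → ℝ) × ℝ × ℝ) := {p | paramStat β p.1 ∈ U ∧ R < p.2.1 + p.2.2 ^ 2} with hA
  have hAm : MeasurableSet A := by
    refine MeasurableSet.inter ?_ (measurableSet_lt measurable_const
      (measurable_snd.fst.add (measurable_snd.snd.pow_const 2)))
    exact ((hU.preimage (continuous_paramStat β)).preimage continuous_fst).measurableSet
  have hn1 : (1 : ℝ) ≤ n := by exact_mod_cast hn
  set box : Set (Fin n → ℝ) := Set.pi Set.univ fun _ : Fin n => Set.Ioo (-1 : ℝ) 1 with hbox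
  have hboxm : MeasurableSet box := MeasurableSet.univ_pi fun _ => measurableSet_Ioo
  have hvol : volume box = ENNReal.ofReal (exp (n * log 2)) := by
    rw [← Measure.restrict_apply_univ, volume_restrict_pi_Ioo, Measure.smul_apply, measure_univ,
      mul_comm (n : ℝ), exp_mul, exp_log two_pos, rpow_natCast, ENNReal.ofReal_pow two_pos.le]
    simp
  have hle : ∀ z ∈ configSet n A,
      n * rateFun β lam (avgMap z) ≤ n * (C - κ * R) + -κ * z.2 ^ 2 := by
    rintro ⟨m, y⟩ ⟨hm, hz1, hz2⟩
    have hm' : ∀ i, m i ∈ Set.Ioo (-1 : ℝ) 1 := fun i => hm i trivial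
    have hq : Qf m ∈ Set.Icc η 1 := hUsub _ ((params_eq_paramStat hn hm' β).symm ▸ hz1)
    have hb := Jf_sub_le hβ hlam hη hn hm' hq y
    rw [Jf_eq_JStat hn hm'] at hb
    have h0 : 0 ≤ avgSq m := avgSq_nonneg
    simp only [avgMap] at hz2
    have e : (avgSq m + y ^ 2) / (24 * β ^ 2) = 2 * κ * (avgSq m + y ^ 2) := by
      rw [hκ]; ring
    rw [e, ← hC] at hb
    have h1 : rateFun β lam (avgMap (m, y)) ≤ C - κ * R - κ * y ^ 2 := by
      simp only [rateFun, avgMap]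
      nlinarith
    have h2 : (n : ℝ) * (κ * y ^ 2) ≥ κ * y ^ 2 := le_mul_of_one_le_left (by positivity) hn1
    have h3 := mul_le_mul_of_nonneg_left h1 (by linarith : (0 : ℝ) ≤ n)
    simp only
    linarith
  calc expInt β lam n A
      ≤ ∫⁻ z in configSet n A, ENNReal.ofReal (exp (n * (C - κ * R)))
          * ENNReal.ofReal (exp (-κ * z.2 ^ 2)) := by
        refine setLIntegral_mono' (measurableSet_configSet n hAm) fun z hz => ?_
        rw [← ENNReal.ofReal_mul (exp_pos _).le, ← exp_add]
        exact ENNReal.ofReal_le_ofReal (exp_le_exp.2 (hle z hz))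
    _ ≤ ∫⁻ z in box ×ˢ Set.univ, ENNReal.ofReal (exp (n * (C - κ * R)))
          * ENNReal.ofReal (exp (-κ * z.2 ^ 2)) :=
        lintegral_mono_set fun z hz => ⟨hz.1, trivial⟩
    _ = (ENNReal.ofReal (exp (n * (C - κ * R))) * volume box)
          * ∫⁻ y : ℝ, ENNReal.ofReal (exp (-κ * y ^ 2)) := by
        rw [Measure.volume_eq_prod, ← Measure.prod_restrict, Measure.restrict_univ,
          lintegral_prod_mul (f := fun _ => ENNReal.ofReal (exp (n * (C - κ * R))))
            (g := fun y : ℝ => ENNReal.ofReal (exp (-κ * y ^ 2))) (by fun_prop) (by fun_prop),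
          setLIntegral_const]
    _ = _ := by
        rw [hvol, ← ENNReal.ofReal_mul (exp_pos _).le, ← exp_add, mul_comm]
        congr 3
        rw [hR]
        field_simp
        ring

lemma expBound_of_lt {β lam η : ℝ} (hβ : 0 < β) (hlam : 0 ≤ lam) (hη : 0 < η)
    {U : Set (ℝ × ℝ × ℝ × ℝ)} (hU : IsClosed U) (hUsub : ∀ p ∈ U, p.1 ∈ Set.Icc η 1) {r r' : ℝ}
    (hr : (⨆ (ρ : ProbabilityMeasure Int11)
          (_ : (Qm ρ, Mm ρ, Am ρ, Em β ρ) ∈ U) (y : ℝ),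
          (JE β lam ρ y - relEnt (ρ : Measure Int11) unif11
            - ((y ^ 2 / (2 * β ^ 2) : ℝ) : EReal) + ((Real.log 2 : ℝ) : EReal))) ≤ (r : EReal))
    (hrr : r < r') : ExpBound β lam r' {p | paramStat β p.1 ∈ U} := by
  obtain ⟨R, hR⟩ := exists_expBound_tail hβ hlam hη hU hUsub r'
  have hAc : IsClosed {p : (Fin 5 → ℝ) × ℝ × ℝ | paramStat β p.1 ∈ U} :=
    (hU.preimage (continuous_paramStat β)).preimage continuous_fst
  have hK := (isCompact_closedBall (0 : (Fin 5 → ℝ) × ℝ × ℝ) (R + 2)).inter_left hAc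
  refine ((expBound_compact hβ lam hr hrr hK
    (fun p hp => hη.trans_le (hUsub _ hp.1).1) fun p hp => hp.1).union hR).mono_of_configSet ?_
  rintro n hn ⟨m, y⟩ ⟨hm, hz⟩
  refine ⟨hm, ?_⟩
  have hm' : ∀ i, m i ∈ Set.Ioo (-1 : ℝ) 1 := fun i => hm i trivial
  rcases lt_or_ge R (avgSq m + y ^ 2) with h | h
  · exact Or.inr ⟨hz, h⟩
  · have h0 : 0 ≤ avgSq m := avgSq_nonneg
    refine Or.inl ⟨hz, ?_⟩
    rw [mem_closedBall_zero_iff, avgMap, norm_prod_le_iff, norm_prod_le_iff,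
      pi_norm_le_iff_of_nonneg (by nlinarith [sq_nonneg y])]
    refine ⟨fun k => (abs_avgStat_le hn hm' k).trans (by nlinarith [sq_nonneg y]), ?_, ?_⟩
    · rw [norm_eq_abs, abs_of_nonneg h0]; nlinarith [sq_nonneg y]
    · rw [norm_eq_abs]; nlinarith [sq_abs y, sq_nonneg (|y| - 1)]

lemma eventually_prefactor_le (a c C₀ : ℝ) (ha : 0 ≤ a) (hc : 0 ≤ c) {γ : ℝ} (hγ : γ < 1)
    {ε : ℝ} (hε : 0 < ε) :
    ∀ᶠ n : ℕ in atTop, √(n / a) * exp (C₀ * (n : ℝ) ^ γ) * c ≤ exp (n * ε) := by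
  have h1 : ∀ᶠ n : ℕ in atTop, C₀ * (n : ℝ) ^ γ ≤ n * (ε / 2) := by
    have h := ((tendsto_rpow_neg_atTop (sub_pos.2 hγ)).comp
      (tendsto_natCast_atTop_atTop (R := ℝ))).const_mul C₀
    rw [mul_zero] at h
    filter_upwards [h.eventually_le_const (half_pos hε), eventually_gt_atTop 0] with n hn hn0
    have hn' : (0 : ℝ) < n := by exact_mod_cast hn0
    have e : C₀ * (n : ℝ) ^ γ = n * (C₀ * (n : ℝ) ^ (-(1 - γ))) := by
      rw [neg_sub, rpow_sub_one hn'.ne']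
      field_simp
    rw [e]
    exact mul_le_mul_of_nonneg_left hn hn'.le
  have h2 : ∀ᶠ n : ℕ in atTop, 8 * (1 / a + 1) * c / ε ^ 2 ≤ (n : ℝ) :=
    tendsto_natCast_atTop_atTop.eventually_ge_atTop _
  filter_upwards [h1, h2, eventually_ge_atTop 1] with n hn1 hn2 hn3
  have hn : (1 : ℝ) ≤ n := by exact_mod_cast hn3
  rw [div_le_iff₀ (by positivity)] at hn2
  have hq := quadratic_le_exp_of_nonneg (x := n * (ε / 2)) (by positivity)
  have hs : √(n / a) ≤ n * (1 / a + 1) := by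
    have h : √(n / a) ≤ n / a + 1 := by
      nlinarith [sq_sqrt (show 0 ≤ n / a by positivity), sq_nonneg (√(n / a) - 1)]
    have e : (n : ℝ) / a = n * (1 / a) := by ring
    linarith
  have hsc : √(n / a) * c ≤ exp (n * (ε / 2)) := by
    have : √(n / a) * c ≤ n * (1 / a + 1) * c := by gcongr
    nlinarith [mul_nonneg (by linarith : (0 : ℝ) ≤ n) hε.le]
  calc √(n / a) * exp (C₀ * (n : ℝ) ^ γ) * c
      = √(n / a) * c * exp (C₀ * (n : ℝ) ^ γ) := by ring
    _ ≤ exp (n * (ε / 2)) * exp (n * (ε / 2)) := by gcongr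
    _ = exp (n * ε) := by rw [← exp_add]; congr 1; ring

end

/-- **Proposition 3.5 (variational upper bound).** For closed `U ⊆ [η,1] × ℝ³`,
`limsup_n n⁻¹ log T(U,V_n)
  ≤ sup_{ρ : (Q,M,A,E)(ρ) ∈ U} sup_{y ∈ ℝ} {J(ρ,y) − H(ρ|π₀) − y²/(2β²) + log 2}`. -/
theorem variational_upper_bound (β lam η b C₀ : ℝ) (hβ : 0 < β) (hlam : 0 ≤ lam)
    (hη : η ∈ Set.Ioo (0 : ℝ) 1) (hb : b ∈ Set.Ioo (0 : ℝ) 1) (hC₀ : 0 < C₀)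
    (U : Set (ℝ × ℝ × ℝ × ℝ)) (hU : IsClosed U)
    (hUsub : ∀ p ∈ U, p.1 ∈ Set.Icc η 1) :
    limsup (fun n : ℕ => ((n : ℝ)⁻¹ : EReal) * ENNReal.log (Tval n β lam C₀ b U)) atTop
      ≤ ⨆ (ρ : ProbabilityMeasure Int11)
          (_ : (Qm ρ, Mm ρ, Am ρ, Em β ρ) ∈ U) (y : ℝ),
          (JE β lam ρ y - relEnt (ρ : Measure Int11) unif11
            - ((y ^ 2 / (2 * β ^ 2) : ℝ) : EReal) + ((Real.log 2 : ℝ) : EReal)) := by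
  refine le_of_forall_gt_imp_ge_of_dense fun a ha => ?_
  obtain ⟨z, hz, hza⟩ := EReal.lt_iff_exists_real_btwn.1 ha
  obtain ⟨r', hr', hrz⟩ := EReal.lt_iff_exists_real_btwn.1 hz
  obtain ⟨r, hr, hrr⟩ := EReal.lt_iff_exists_real_btwn.1 hr'
  rw [EReal.coe_lt_coe_iff] at hrz hrr
  obtain ⟨C, hC⟩ := expBound_of_lt hβ hlam hη.1 hU hUsub hr.le hrr
  refine (limsup_le_of_le (by isBoundedDefault) ?_).trans hza.le
  have hγ : max 0.9 b < 1 := max_lt (by norm_num) hb.2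
  filter_upwards [eventually_prefactor_le (2 * π * β ^ 2) C C₀ (by positivity) C.2 hγ
    (sub_pos.2 hrz), eventually_gt_atTop 0] with n hn hn0
  have hn' : (0 : ℝ) < n := by exact_mod_cast hn0
  have hT : Tval n β lam C₀ b U ≤ ENNReal.ofReal (exp (n * z)) := by
    refine (Tval_le hU hn0).trans ?_
    calc _ ≤ ENNReal.ofReal (√(n / (2 * π * β ^ 2)))
      * (ENNReal.ofReal (exp (C₀ * (n : ℝ) ^ max 0.9 b))
        * (C * ENNReal.ofReal (exp (n * r')))) := by gcongr; exact hC n hn0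
      _ = ENNReal.ofReal (√(n / (2 * π * β ^ 2)) * exp (C₀ * (n : ℝ) ^ max 0.9 b) * C
            * exp (n * r')) := by
          rw [ENNReal.ofReal_mul (by positivity), ENNReal.ofReal_mul (by positivity),
            ENNReal.ofReal_mul (by positivity), ENNReal.ofReal_coe_nnreal]
          ring
      _ ≤ ENNReal.ofReal (exp (n * (z - r')) * exp (n * r')) := by gcongr
      _ = ENNReal.ofReal (exp (n * z)) := by rw [← exp_add]; congr 2; ring
  have hlog : ENNReal.log (Tval n β lam C₀ b U) ≤ ((n * z : ℝ) : EReal) := by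
    refine (ENNReal.log_monotone hT).trans ?_
    rw [ENNReal.log_ofReal_of_pos (exp_pos _), log_exp]
  have hinv : (((n : ℝ) : EReal))⁻¹ = (((n : ℝ)⁻¹ : ℝ) : EReal) := (EReal.coe_inv _).symm
  rw [hinv]
  calc (((n : ℝ)⁻¹ : ℝ) : EReal) * ENNReal.log (Tval n β lam C₀ b U)
      ≤ (((n : ℝ)⁻¹ : ℝ) : EReal) * ((n * z : ℝ) : EReal) :=
        mul_le_mul_of_nonneg_left hlog (by positivity)
    _ = (z : EReal) := by
        rw [← EReal.coe_mul]
        congr 1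
        field_simp

end
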